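/- arXiv:2505.17981 — 2 statements merged into one kernel-verified Lean document; each statement's English description precedes it below -/
import Mathlib

section
/- Fix k ≥ 2 and suppose 1/n ≪ ε ≪ η, 1/k. Let H be a k-uniform hypergraph on n vertices admitting a fractional matching w such that w_u = Σ_{e ∋ u} w(e) ≥ 1 − ε for every vertex u and w_{uv} = Σ_{e ⊇ {u,v}} w(e) ≤ ε for all distinct u, v. Then H contains a matching of size at least (1 − η)·n/k. -/
open Finset

variable {V : Type*} [Fintype V] [DecidableEq V]

/-- The degree of a vertex set `S` in a hypergraph `H`: the number of edges containing `S`. -/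
def deg (H : Finset (Finset V)) (S : Finset V) : ℕ :=
  (H.filter fun e => S ⊆ e).card

/-- The minimum positive codegree of a `k`-uniform hypergraph `H`: the minimum of `deg S`
over all `(k-1)`-sets `S` with `deg S ≥ 1`. -/
noncomputable def minPosCodeg (k : ℕ) (H : Finset (Finset V)) : ℕ :=
  sInf {d | ∃ S : Finset V, S.card = k - 1 ∧ 0 < deg H S ∧ deg H S = d}

/-- `w` is a fractional matching of `H`: nonnegative weights supported on edges,
with total weight at most 1 at each vertex. -/
def IsFracMatching (H : Finset (Finset V)) (w : Finset V → ℝ) : Prop :=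
  (∀ e, 0 ≤ w e) ∧ (∀ e ∉ H, w e = 0) ∧
    ∀ v : V, (∑ e ∈ H.filter fun e => v ∈ e, w e) ≤ 1

/-- `w` is a perfect fractional matching of `H`: nonnegative weights supported on edges,
with total weight exactly 1 at each vertex. -/
def IsPerfFracMatching (H : Finset (Finset V)) (w : Finset V → ℝ) : Prop :=
  (∀ e, 0 ≤ w e) ∧ (∀ e ∉ H, w e = 0) ∧
    ∀ v : V, (∑ e ∈ H.filter fun e => v ∈ e, w e) = 1

/-! The matching is produced by the random greedy process: in each step an edge `e` is proposed with
probability `τ * w e` and accepted if all its vertices are still uncovered. The probability that a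
set `S` is uncovered after `j` steps satisfies a linear recursion, and it stays close to
`survival r τ j ^ #S`. -/

section GreedyProcess

variable {α : Type*} [DecidableEq α]

/-- The averaging operator of one step of the random greedy matching process, acting on functions
of the set of uncovered vertices. -/
noncomputable def greedyStep (H : Finset (Finset α)) (w : Finset α → ℝ) (τ : ℝ) :
    (Finset α → ℝ) →ₗ[ℝ] (Finset α → ℝ) where
  toFun F U := F U + τ * ∑ e ∈ H with e ⊆ U, w e * (F (U \ e) - F U)
  map_add' F G := by
    ext U
    simp only [Pi.add_apply, add_sub_add_comm, mul_add, sum_add_distrib]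
    ring
  map_smul' c F := by
    ext U
    simp only [Pi.smul_apply, smul_eq_mul, RingHom.id_apply, ← mul_sub, mul_left_comm _ c,
      ← mul_sum]
    ring

/-- The indicator function of the event that all of `S` is uncovered. -/
noncomputable def uncoveredInd (S U : Finset α) : ℝ := if S ⊆ U then 1 else 0

/-- The probability that all of `S` is uncovered after `j` steps of the greedy process. -/
noncomputable def uncoveredProb [Fintype α] (H : Finset (Finset α)) (w : Finset α → ℝ) (τ : ℝ)
    (S : Finset α) (j : ℕ) : ℝ :=
  (greedyStep H w τ ^ j) (uncoveredInd S) univ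

variable {H : Finset (Finset α)} {w : Finset α → ℝ} {τ : ℝ}

lemma greedyStep_apply (F : Finset α → ℝ) (U : Finset α) :
    greedyStep H w τ F U = F U + τ * ∑ e ∈ H with e ⊆ U, w e * (F (U \ e) - F U) := rfl

lemma greedyStep_sub_const (F : Finset α → ℝ) (U : Finset α) (a : ℝ) :
    greedyStep H w τ F U - a = (F U - a) * (1 - τ * ∑ e ∈ H with e ⊆ U, w e) +
      τ * ∑ e ∈ H with e ⊆ U, w e * (F (U \ e) - a) := by
  have h : ∑ e ∈ H with e ⊆ U, w e * (F (U \ e) - F U) =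
      ∑ e ∈ H with e ⊆ U, w e * (F (U \ e) - a) - (F U - a) * ∑ e ∈ H with e ⊆ U, w e := by
    rw [mul_sum, ← sum_sub_distrib]
    exact sum_congr rfl fun e _ => by ring
  rw [greedyStep_apply, h]
  ring

lemma mul_sum_filter_lt_one (hw : ∀ e, 0 ≤ w e) (hτ : 0 ≤ τ) (hτw : τ * ∑ e ∈ H, w e < 1)
    (U : Finset α) : τ * ∑ e ∈ H with e ⊆ U, w e < 1 :=
  lt_of_le_of_lt (mul_le_mul_of_nonneg_left
    (sum_le_sum_of_subset_of_nonneg (filter_subset _ _) fun e _ _ => hw e) hτ) hτw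

lemma le_greedyStep (hw : ∀ e, 0 ≤ w e) (hτ : 0 ≤ τ) (hτw : τ * ∑ e ∈ H, w e < 1)
    {F : Finset α → ℝ} {a : ℝ} (hF : ∀ U, a ≤ F U) (U : Finset α) :
    a ≤ greedyStep H w τ F U := by
  rw [← sub_nonneg, greedyStep_sub_const]
  have h1 := mul_sum_filter_lt_one hw hτ hτw U
  have h2 : 0 ≤ ∑ e ∈ H with e ⊆ U, w e * (F (U \ e) - a) :=
    sum_nonneg fun e _ => mul_nonneg (hw e) (sub_nonneg.2 (hF _))
  have h3 := hF U
  exact add_nonneg (mul_nonneg (by linarith) (by linarith)) (mul_nonneg hτ h2)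

lemma le_greedyStep_pow (hw : ∀ e, 0 ≤ w e) (hτ : 0 ≤ τ) (hτw : τ * ∑ e ∈ H, w e < 1)
    {F : Finset α → ℝ} {a : ℝ} (hF : ∀ U, a ≤ F U) (j : ℕ) (U : Finset α) :
    a ≤ (greedyStep H w τ ^ j) F U := by
  induction j generalizing U with
  | zero => simpa using hF U
  | succ j ih =>
    rw [pow_succ', Module.End.mul_apply]
    exact le_greedyStep hw hτ hτw ih U

lemma exists_greedyStep_ge (hw : ∀ e, 0 ≤ w e) (hτ : 0 ≤ τ) (hτw : τ * ∑ e ∈ H, w e < 1)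
    (F : Finset α → ℝ) (U : Finset α) :
    F U ≤ greedyStep H w τ F U ∨ ∃ e ∈ H, e ⊆ U ∧ F (U \ e) ≤ greedyStep H w τ F U := by
  by_contra! h
  obtain ⟨h1, h2⟩ := h
  have h3 := greedyStep_sub_const (H := H) (w := w) (τ := τ) F U (greedyStep H w τ F U)
  have h4 := mul_sum_filter_lt_one hw hτ hτw U
  have h5 : 0 ≤ ∑ e ∈ H with e ⊆ U, w e * (F (U \ e) - greedyStep H w τ F U) :=
    sum_nonneg fun e he => by
      rw [mem_filter] at he
      exact mul_nonneg (hw e) (sub_nonneg.2 (h2 e he.1 he.2).le)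
  have h6 := mul_pos (sub_pos.2 h1) (sub_pos.2 h4)
  have h7 := mul_nonneg hτ h5
  linarith

lemma exists_matching_le_greedyStep_pow [Fintype α] (hw : ∀ e, 0 ≤ w e) (hτ : 0 ≤ τ)
    (hτw : τ * ∑ e ∈ H, w e < 1) (F : Finset α → ℝ) (j : ℕ) {M : Finset (Finset α)}
    (hMH : M ⊆ H) (hM : (M : Set (Finset α)).PairwiseDisjoint id) :
    ∃ M' ⊆ H, (M' : Set (Finset α)).PairwiseDisjoint id ∧
      F (univ \ M'.biUnion id) ≤ (greedyStep H w τ ^ j) F (univ \ M.biUnion id) := by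
  induction j generalizing M with
  | zero => exact ⟨M, hMH, hM, by simp⟩
  | succ j ih =>
    rw [pow_succ', Module.End.mul_apply]
    obtain h | ⟨e, he, heU, h⟩ := exists_greedyStep_ge hw hτ hτw ((greedyStep H w τ ^ j) F)
      (univ \ M.biUnion id)
    · obtain ⟨M', h1, h2, h3⟩ := ih hMH hM
      exact ⟨M', h1, h2, h3.trans h⟩
    · have hd : ∀ f ∈ M, Disjoint e f := fun f hf =>
        (disjoint_of_subset_left heU sdiff_disjoint).mono_right (subset_biUnion_of_mem id hf)
      obtain ⟨M', h1, h2, h3⟩ := ih (M := insert e M) (insert_subset he hMH) (by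
        rw [coe_insert]
        exact hM.insert fun f hf _ => hd f hf)
      refine ⟨M', h1, h2, h3.trans ?_⟩
      rwa [biUnion_insert, id, union_comm, ← sup_eq_union, ← sdiff_sdiff_left]

lemma greedyStep_uncoveredInd (S : Finset α) :
    greedyStep H w τ (uncoveredInd S) =
      uncoveredInd S - τ • ∑ e ∈ H with ¬Disjoint e S, w e • uncoveredInd (S ∪ e) := by
  ext U
  rw [greedyStep_apply, Pi.sub_apply, Pi.smul_apply, Finset.sum_apply, smul_eq_mul,
    sub_eq_add_neg, ← mul_neg, ← sum_neg_distrib, sum_filter, sum_filter]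
  congr 2
  refine sum_congr rfl fun e _ => ?_
  simp only [uncoveredInd, Pi.smul_apply, smul_eq_mul, union_subset_iff, subset_sdiff,
    disjoint_comm (a := S)]
  by_cases h1 : e ⊆ U <;> by_cases h2 : S ⊆ U <;> by_cases h3 : Disjoint e S <;> simp [h1, h2, h3]

lemma uncoveredProb_zero [Fintype α] (S : Finset α) : uncoveredProb H w τ S 0 = 1 := by
  simp [uncoveredProb, uncoveredInd]

lemma uncoveredProb_succ [Fintype α] (S : Finset α) (j : ℕ) :
    uncoveredProb H w τ S (j + 1) = uncoveredProb H w τ S j -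
      τ * ∑ e ∈ H with ¬Disjoint e S, w e * uncoveredProb H w τ (S ∪ e) j := by
  simp only [uncoveredProb, pow_succ, Module.End.mul_apply, greedyStep_uncoveredInd, map_sub,
    map_smul, map_sum, Pi.sub_apply, Pi.smul_apply, Finset.sum_apply, smul_eq_mul]

lemma uncoveredProb_nonneg [Fintype α] (hw : ∀ e, 0 ≤ w e) (hτ : 0 ≤ τ)
    (hτw : τ * ∑ e ∈ H, w e < 1) (S : Finset α) (j : ℕ) : 0 ≤ uncoveredProb H w τ S j :=
  le_greedyStep_pow hw hτ hτw (fun U => by unfold uncoveredInd; split_ifs <;> norm_num) j univ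

lemma uncoveredProb_le_one [Fintype α] (hw : ∀ e, 0 ≤ w e) (hτ : 0 ≤ τ)
    (hτw : τ * ∑ e ∈ H, w e < 1) (S : Finset α) (j : ℕ) : uncoveredProb H w τ S j ≤ 1 := by
  have h := le_greedyStep_pow hw hτ hτw (F := -uncoveredInd S) (a := -1)
    (fun U => by simp only [Pi.neg_apply, uncoveredInd]; split_ifs <;> norm_num) j univ
  rw [map_neg, Pi.neg_apply] at h
  exact neg_le_neg_iff.1 h

lemma sum_mul_card_inter (S : Finset α) :
    ∑ e ∈ H, w e * #(e ∩ S) = ∑ v ∈ S, ∑ e ∈ H with v ∈ e, w e := by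
  simp only [sum_filter]
  rw [sum_comm]
  refine sum_congr rfl fun e _ => ?_
  rw [← sum_filter, sum_const, filter_mem_eq_inter, inter_comm, nsmul_eq_mul, mul_comm]

lemma sum_mul_card_inter_pairs (S : Finset α) :
    ∑ e ∈ H, w e * (#(e ∩ S) * (#(e ∩ S) - 1)) =
      ∑ p ∈ S.offDiag, ∑ e ∈ H with p.1 ∈ e ∧ p.2 ∈ e, w e := by
  simp only [sum_filter]
  rw [sum_comm]
  refine sum_congr rfl fun e _ => ?_
  have h : S.offDiag.filter (fun p => p.1 ∈ e ∧ p.2 ∈ e) = (e ∩ S).offDiag := by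
    ext p
    simp only [mem_filter, mem_offDiag, mem_inter]
    tauto
  rw [← sum_filter, sum_const, h, offDiag_card, nsmul_eq_mul, Nat.cast_sub (Nat.le_mul_self _)]
  push_cast
  ring

/-- If the edges meeting `S` in a single vertex have values within `D` of `x`, then the weighted sum
of the values over all edges meeting `S` is close to `#S * x`. -/
lemma abs_sum_meeting_sub_le {ε x D : ℝ} {q : Finset α → ℝ} (S : Finset α) (hw : ∀ e, 0 ≤ w e)
    (hε : 0 ≤ ε) (hdeg : ∀ v, ∑ e ∈ H with v ∈ e, w e ≤ 1)
    (hdeg' : ∀ v, 1 - ε ≤ ∑ e ∈ H with v ∈ e, w e)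
    (hcodeg : ∀ u v, u ≠ v → ∑ e ∈ H with u ∈ e ∧ v ∈ e, w e ≤ ε)
    (hx : 0 ≤ x) (hx' : x ≤ 1) (hD : 0 ≤ D) (hq : ∀ e, 0 ≤ q e) (hq' : ∀ e, q e ≤ 1)
    (hqx : ∀ e ∈ H, #(e ∩ S) = 1 → |q e - x| ≤ D) :
    |∑ e ∈ H with ¬Disjoint e S, w e * q e - #S * x| ≤ #S * D + 2 * #S ^ 2 * ε := by
  have hA : ∑ e ∈ H, w e * #(e ∩ S) ≤ #S := by
    rw [sum_mul_card_inter]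
    simpa using sum_le_sum fun v (_ : v ∈ S) => hdeg v
  have hA' : #S * (1 - ε) ≤ ∑ e ∈ H, w e * #(e ∩ S) := by
    rw [sum_mul_card_inter]
    rw [← nsmul_eq_mul]
    exact card_nsmul_le_sum _ _ _ fun v _ => hdeg' v
  have hB : ∑ e ∈ H, w e * ((#(e ∩ S) : ℝ) * (#(e ∩ S) - 1)) ≤ (#S : ℝ) ^ 2 * ε := by
    rw [sum_mul_card_inter_pairs]
    refine (sum_le_sum fun p hp => hcodeg p.1 p.2 (mem_offDiag.1 hp).2.2).trans ?_
    rw [sum_const, offDiag_card, nsmul_eq_mul, Nat.cast_sub (Nat.le_mul_self _)]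
    push_cast
    exact mul_le_mul_of_nonneg_right (by nlinarith [Nat.cast_nonneg (α := ℝ) #S]) hε
  have key : ∀ e ∈ H, (#(e ∩ S) : ℝ) * (x - D) - #(e ∩ S) * (#(e ∩ S) - 1) ≤
        (if ¬Disjoint e S then q e else 0) ∧ (if ¬Disjoint e S then q e else 0) ≤
        (#(e ∩ S) : ℝ) * (x + D) + #(e ∩ S) * (#(e ∩ S) - 1) := by
    intro e he
    have h0 : Disjoint e S ↔ #(e ∩ S) = 0 := by rw [card_eq_zero, disjoint_iff_inter_eq_empty]
    simp only [h0]
    have hqe := hq e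
    have hqe' := hq' e
    have hqxe := hqx e he
    generalize #(e ∩ S) = c at *
    obtain rfl | rfl | hc : c = 0 ∨ c = 1 ∨ 2 ≤ c := by omega
    · simp
    · have h2 := abs_le.1 (hqxe rfl)
      norm_num
      constructor <;> linarith
    · have hc' : (2 : ℝ) ≤ c := by exact_mod_cast hc
      rw [if_pos (by omega)]
      constructor <;> nlinarith [mul_nonneg hx hD]
  have hS : ∑ e ∈ H with ¬Disjoint e S, w e * q e =
      ∑ e ∈ H, w e * (if ¬Disjoint e S then q e else 0) := by
    rw [sum_filter]
    exact sum_congr rfl fun e _ => by split_ifs <;> simp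
  have hupper := sum_le_sum fun e he => mul_le_mul_of_nonneg_left (key e he).2 (hw e)
  have hlower := sum_le_sum fun e he => mul_le_mul_of_nonneg_left (key e he).1 (hw e)
  simp only [mul_add (w _), mul_sub (w _) (_ * (x - D)), sum_add_distrib, sum_sub_distrib,
    ← mul_assoc (w _) _ (x + D), ← mul_assoc (w _) _ (x - D), ← sum_mul] at hupper hlower
  rw [← hS] at hupper hlower
  have hSS : (#S : ℝ) ≤ (#S : ℝ) ^ 2 := by exact_mod_cast Nat.le_self_pow two_ne_zero _
  have hSε := mul_le_mul_of_nonneg_right hSS hε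
  have hSx : (#S : ℝ) * ε * x ≤ #S * ε :=
    mul_le_of_le_one_right (mul_nonneg (Nat.cast_nonneg _) hε) hx'
  rw [abs_le]
  constructor
  · nlinarith [mul_le_mul_of_nonneg_right hA' hx, mul_le_mul_of_nonneg_right hA hD]
  · nlinarith [mul_le_mul_of_nonneg_right hA hx, mul_le_mul_of_nonneg_right hA hD]

end GreedyProcess

/-- The Euler scheme with step size `τ` for the limiting equation `f' = -f ^ (r + 1)`. -/
noncomputable def survival (r : ℕ) (τ : ℝ) : ℕ → ℝ
  | 0 => 1
  | j + 1 => survival r τ j - τ * survival r τ j ^ (r + 1)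

/-- An upper bound for the error made by approximating the probability that `m` vertices are
uncovered after `j` steps by `survival r τ j ^ m`. -/
noncomputable def survivalError (r : ℕ) (τ ε : ℝ) : ℕ → ℕ → ℝ
  | _, 0 => 0
  | m, j + 1 =>
    min 1 (survivalError r τ ε m j + τ * (m * survivalError r τ ε (m + r) j + 3 * m ^ 2 * ε))

section Survival

variable {r : ℕ} {τ ε : ℝ}

lemma survival_mem (hτ : 0 ≤ τ) (hτ' : τ ≤ 1) (j : ℕ) :
    0 ≤ survival r τ j ∧ survival r τ j ≤ 1 := by
  induction j with
  | zero => simp [survival]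
  | succ j ih =>
    obtain ⟨h0, h1⟩ := ih
    have h2 : survival r τ j ^ (r + 1) ≤ survival r τ j := pow_le_of_le_one h0 h1 (by omega)
    have h3 : 0 ≤ survival r τ j ^ (r + 1) := pow_nonneg h0 _
    simp only [survival]
    constructor <;> nlinarith

lemma survival_le_or (hτ : 0 ≤ τ) (hτ' : τ ≤ 1) {a : ℝ} (ha : 0 ≤ a) (j : ℕ) :
    survival r τ j ≤ a ∨ survival r τ j ≤ 1 - j * τ * a ^ (r + 1) := by
  induction j with
  | zero => simp [survival]
  | succ j ih =>
    have h0 := (survival_mem (r := r) hτ hτ' j).1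
    have h3 := mul_nonneg hτ (pow_nonneg h0 (r + 1))
    simp only [survival]
    by_cases h : survival r τ j ≤ a
    · left; linarith
    · right
      have h4 := mul_le_mul_of_nonneg_left (pow_le_pow_left₀ ha (not_le.1 h).le (r + 1)) hτ
      push_cast
      linarith [ih.resolve_left h]

lemma one_sub_pow_le {y : ℝ} (hy : 0 ≤ y) (hy' : y ≤ 1) (m : ℕ) :
    (1 - y) ^ m ≤ 1 - m * y + m ^ 2 * y ^ 2 := by
  induction m with
  | zero => simp
  | succ m ih =>
    rw [pow_succ]
    have h := mul_le_mul_of_nonneg_right ih (sub_nonneg.2 hy')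
    have h2 : 0 ≤ (m : ℝ) ^ 2 * y ^ 3 := by positivity
    have h3 : 0 ≤ (m : ℝ) * y ^ 2 := by positivity
    push_cast
    nlinarith [sq_nonneg y]

lemma abs_survival_succ_pow_sub_le (hτ : 0 ≤ τ) (hτ' : τ ≤ 1) (j m : ℕ) :
    |survival r τ j ^ m - τ * (m * survival r τ j ^ (m + r)) - survival r τ (j + 1) ^ m| ≤
      m ^ 2 * τ ^ 2 := by
  obtain ⟨h0, h1⟩ := survival_mem (r := r) hτ hτ' j
  simp only [survival]
  generalize survival r τ j = f at *
  have hfr : f ^ r ≤ 1 := pow_le_one₀ h0 h1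
  have hfr0 : 0 ≤ f ^ r := pow_nonneg h0 _
  have hfm : f ^ m ≤ 1 := pow_le_one₀ h0 h1
  have hfm0 : 0 ≤ f ^ m := pow_nonneg h0 _
  have hy0 : 0 ≤ τ * f ^ r := mul_nonneg hτ hfr0
  have hyτ : τ * f ^ r ≤ τ := mul_le_of_le_one_right hτ hfr
  have e : f ^ m - τ * (m * f ^ (m + r)) - (f - τ * f ^ (r + 1)) ^ m =
      -(f ^ m * ((1 - τ * f ^ r) ^ m - (1 - m * (τ * f ^ r)))) := by
    rw [show f - τ * f ^ (r + 1) = f * (1 - τ * f ^ r) by ring, mul_pow, pow_add]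
    ring
  have hlo : 0 ≤ (1 - τ * f ^ r) ^ m - (1 - m * (τ * f ^ r)) := by
    have := one_add_mul_le_pow (a := -(τ * f ^ r)) (by linarith) m
    rw [← sub_eq_add_neg] at this
    linarith
  have hhi := one_sub_pow_le hy0 (hyτ.trans hτ') m
  have hsq : (m : ℝ) ^ 2 * (τ * f ^ r) ^ 2 ≤ m ^ 2 * τ ^ 2 := by gcongr
  rw [e, abs_neg, abs_of_nonneg (mul_nonneg hfm0 hlo)]
  exact (mul_le_of_le_one_left hlo hfm).trans (by linarith)

lemma survivalError_nonneg (hτ : 0 ≤ τ) (hε : 0 ≤ ε) (m j : ℕ) :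
    0 ≤ survivalError r τ ε m j := by
  induction j generalizing m with
  | zero => simp [survivalError]
  | succ j ih =>
    have h1 := ih m
    have h2 := ih (m + r)
    simp only [survivalError]
    positivity

lemma survivalError_le_one (m j : ℕ) : survivalError r τ ε m j ≤ 1 := by
  cases j with
  | zero => simp [survivalError]
  | succ j => exact min_le_left _ _

/-- Over a time window of length at most `1 / (2 * (4 ^ r + 1))` errors grow from at most
`c * 2 ^ m` to at most `c * 4 ^ m`, provided that these bounds are trivial for sets of size larger
than `K`. -/
lemma survivalError_window (hτ : 0 ≤ τ) (hε : 0 ≤ ε) {K : ℕ} {c : ℝ} (hc : 0 < c)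
    (hcK : 1 ≤ c * 2 ^ K) (hεc : 3 * K * ε ≤ c) {i : ℕ}
    (hi : ∀ m ≤ K, survivalError r τ ε m i ≤ c) {l : ℕ}
    (hl : l * τ * (4 ^ r + 1) ≤ 1 / 2) (m : ℕ) :
    survivalError r τ ε m (i + l) ≤ c * 4 ^ m := by
  have hexp : ∀ l : ℕ, l * τ * (4 ^ r + 1) ≤ 1 / 2 → 2 * (1 + τ * (4 ^ r + 1)) ^ l ≤ 4 := by
    intro l hl
    have h1 : (1 + τ * (4 ^ r + 1)) ^ l ≤ Real.exp (1 / 2) := by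
      calc (1 + τ * (4 ^ r + 1)) ^ l ≤ Real.exp (τ * (4 ^ r + 1)) ^ l := by
            refine pow_le_pow_left₀ (by positivity) ?_ l
            linarith [Real.add_one_le_exp (τ * (4 ^ r + 1))]
        _ = Real.exp (l * τ * (4 ^ r + 1)) := by rw [← Real.exp_nat_mul, mul_assoc]
        _ ≤ _ := Real.exp_le_exp.2 hl
    have h2 : Real.exp (1 / 2) ^ 2 ≤ 4 := by
      rw [← Real.exp_nat_mul]
      norm_num
      linarith [Real.exp_one_lt_d9]
    nlinarith [Real.exp_pos (1 / 2)]
  have hbase : ∀ l : ℕ, 1 ≤ (1 + τ * (4 ^ r + 1)) ^ l := fun l =>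
    one_le_pow₀ (by linarith [mul_nonneg hτ (by positivity : (0 : ℝ) ≤ 4 ^ r + 1)])
  have hmain : ∀ m, survivalError r τ ε m (i + l) ≤ c * (2 * (1 + τ * (4 ^ r + 1)) ^ l) ^ m := by
    clear m
    induction l with
    | zero =>
      intro m
      simp only [add_zero, pow_zero, mul_one]
      obtain hm | hm := le_total m K
      · exact (hi m hm).trans (le_mul_of_one_le_right hc.le (one_le_pow₀ one_le_two))
      · exact (survivalError_le_one _ _).trans (hcK.trans
          (mul_le_mul_of_nonneg_left (pow_le_pow_right₀ one_le_two hm) hc.le))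
    | succ l ih =>
      intro m
      have hl' : l * τ * (4 ^ r + 1) ≤ 1 / 2 := by
        refine le_trans ?_ hl
        push_cast
        gcongr
        linarith
      specialize ih hl'
      obtain hm | hm := le_total K m
      · refine (survivalError_le_one _ _).trans (hcK.trans
          (mul_le_mul_of_nonneg_left ?_ hc.le))
        exact (pow_le_pow_right₀ one_le_two hm).trans
          (pow_le_pow_left₀ zero_le_two (by linarith [hbase (l + 1)]) m)
      · refine (min_le_right _ _).trans ?_
        have hg4 := hexp l hl'
        have hg2 : 2 ≤ 2 * (1 + τ * (4 ^ r + 1)) ^ l := by linarith [hbase l]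
        rw [pow_succ _ l, ← mul_assoc 2]
        generalize 2 * (1 + τ * (4 ^ r + 1)) ^ l = g at *
        have hgm : 1 ≤ g ^ m := one_le_pow₀ (by linarith)
        have hb := one_add_mul_le_pow (a := τ * (4 ^ r + 1))
          (by linarith [mul_nonneg hτ (by positivity : (0 : ℝ) ≤ 4 ^ r + 1)]) m
        have hgr : g ^ r ≤ 4 ^ r := pow_le_pow_left₀ (by linarith) hg4 r
        have h1 : (m : ℝ) * survivalError r τ ε (m + r) (i + l) ≤ m * (c * (g ^ m * 4 ^ r)) := by
          refine mul_le_mul_of_nonneg_left ((ih (m + r)).trans ?_) (Nat.cast_nonneg m)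
          rw [pow_add]
          gcongr
        have h2 : 3 * (m : ℝ) ^ 2 * ε ≤ m * (c * g ^ m) := by
          have h3 : 3 * m * ε ≤ c * g ^ m := by
            calc 3 * m * ε ≤ 3 * K * ε := by gcongr
              _ ≤ c := hεc
              _ ≤ c * g ^ m := le_mul_of_one_le_right hc.le hgm
          calc 3 * (m : ℝ) ^ 2 * ε = m * (3 * m * ε) := by ring
            _ ≤ _ := mul_le_mul_of_nonneg_left h3 (Nat.cast_nonneg m)
        calc survivalError r τ ε m (i + l) +
              τ * (m * survivalError r τ ε (m + r) (i + l) + 3 * m ^ 2 * ε)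
            ≤ c * g ^ m + τ * (m * (c * (g ^ m * 4 ^ r)) + m * (c * g ^ m)) := by
              gcongr
              exact ih m
          _ = c * (g ^ m * (1 + m * (τ * (4 ^ r + 1)))) := by ring
          _ ≤ c * (g ^ m * (1 + τ * (4 ^ r + 1)) ^ m) := by gcongr
          _ = c * (g * (1 + τ * (4 ^ r + 1))) ^ m := by rw [mul_pow]
  refine (hmain m).trans ?_
  gcongr
  exact hexp l hl

lemma exists_survivalError_le (r i K : ℕ) {δ : ℝ} (hδ : 0 < δ) :
    ∃ ε₀ : ℝ, 0 < ε₀ ∧ ∀ ε : ℝ, 0 ≤ ε → ε ≤ ε₀ → ∀ τ : ℝ, 0 ≤ τ → ∀ N : ℕ,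
      N * τ * (4 ^ r + 1) ≤ 1 / 2 → ∀ m ≤ K, survivalError r τ ε m (i * N) ≤ δ := by
  induction i generalizing K δ with
  | zero => exact ⟨1, one_pos, fun ε _ _ τ _ N _ m _ => by simpa [survivalError] using hδ.le⟩
  | succ i ih =>
    obtain ⟨L, hL⟩ := exists_pow_lt_of_lt_one (show (0 : ℝ) < δ / 4 ^ K by positivity)
      (show (1 / 2 : ℝ) < 1 by norm_num)
    have hc : (0 : ℝ) < (1 / 2) ^ L := by positivity
    obtain ⟨ε₁, hε₁, h⟩ := ih L hc
    refine ⟨min ε₁ ((1 / 2) ^ L / (3 * (L + 1))), by positivity, fun ε hε hεle τ hτ N hN m hm => ?_⟩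
    rw [add_mul, one_mul]
    refine (survivalError_window hτ hε hc (K := L) ?_ ?_
      (h ε hε (hεle.trans (min_le_left _ _)) τ hτ N hN) hN m).trans ?_
    · rw [← mul_pow]; norm_num
    · have h1 := (le_div_iff₀ (by positivity)).1 (hεle.trans (min_le_right _ _))
      nlinarith
    · rw [lt_div_iff₀ (by positivity)] at hL
      refine le_trans ?_ hL.le
      gcongr
      norm_num

end Survival

lemma abs_uncoveredProb_sub_le {H : Finset (Finset V)} {w : Finset V → ℝ} {τ ε : ℝ} {r : ℕ}
    (hcard : ∀ e ∈ H, #e = r + 1) (hw : ∀ e, 0 ≤ w e) (hε : 0 ≤ ε)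
    (hdeg : ∀ v, ∑ e ∈ H with v ∈ e, w e ≤ 1)
    (hdeg' : ∀ v, 1 - ε ≤ ∑ e ∈ H with v ∈ e, w e)
    (hcodeg : ∀ u v, u ≠ v → ∑ e ∈ H with u ∈ e ∧ v ∈ e, w e ≤ ε)
    (hτ : 0 ≤ τ) (hτ1 : τ ≤ 1) (hτε : τ ≤ ε) (hτw : τ * ∑ e ∈ H, w e < 1)
    (S : Finset V) (j : ℕ) :
    |uncoveredProb H w τ S j - survival r τ j ^ #S| ≤ survivalError r τ ε #S j := by
  induction j generalizing S with
  | zero => simp [uncoveredProb_zero, survival, survivalError]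
  | succ j ih =>
    refine le_min ?_ ?_
    · obtain ⟨h0, h1⟩ := survival_mem (r := r) hτ hτ1 (j + 1)
      rw [abs_le]
      constructor <;> linarith [pow_nonneg h0 #S, pow_le_one₀ h0 h1 (n := #S),
        uncoveredProb_nonneg hw hτ hτw S (j + 1), uncoveredProb_le_one hw hτ hτw S (j + 1)]
    · obtain ⟨h0, h1⟩ := survival_mem (r := r) hτ hτ1 j
      have hsum := abs_sum_meeting_sub_le (x := survival r τ j ^ (#S + r))
        (D := survivalError r τ ε (#S + r) j) (q := fun e => uncoveredProb H w τ (S ∪ e) j)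
        S hw hε hdeg hdeg' hcodeg (pow_nonneg h0 _) (pow_le_one₀ h0 h1)
        (survivalError_nonneg hτ hε _ _) (fun e => uncoveredProb_nonneg hw hτ hτw _ _)
        (fun e => uncoveredProb_le_one hw hτ hτw _ _) (fun e he h => by
          have hc := card_union_add_card_inter S e
          rw [inter_comm, h, hcard e he] at hc
          rw [show #S + r = #(S ∪ e) by omega]
          exact ih _)
      have hpow := abs_survival_succ_pow_sub_le (r := r) hτ hτ1 j #S
      have hττ : (#S : ℝ) ^ 2 * τ ^ 2 ≤ τ * (#S ^ 2 * ε) := by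
        rw [sq τ, mul_left_comm, ← mul_assoc τ, mul_comm τ, mul_assoc, mul_left_comm]
        gcongr
      have hS := ih S
      rw [uncoveredProb_succ]
      rw [abs_le] at hsum hpow hS ⊢
      have hs1 := mul_le_mul_of_nonneg_left hsum.1 hτ
      have hs2 := mul_le_mul_of_nonneg_left hsum.2 hτ
      constructor <;> linarith

theorem stmt14 (k : ℕ) (hk : 2 ≤ k) (η : ℝ) (hη : 0 < η) :
    ∃ ε₀ : ℝ, 0 < ε₀ ∧ ∀ ε : ℝ, 0 < ε → ε ≤ ε₀ →
      ∃ n₀ : ℕ, ∀ n ≥ n₀,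
        ∀ H : Finset (Finset (Fin n)), (∀ e ∈ H, e.card = k) →
        ∀ w : Finset (Fin n) → ℝ, IsFracMatching H w →
          (∀ u : Fin n, 1 - ε ≤ ∑ e ∈ H.filter fun e => u ∈ e, w e) →
          (∀ u v : Fin n, u ≠ v →
            (∑ e ∈ H.filter fun e => u ∈ e ∧ v ∈ e, w e) ≤ ε) →
          ∃ M ⊆ H, (M : Set (Finset (Fin n))).PairwiseDisjoint id ∧
            (1 - η) * n / k ≤ (M.card : ℝ) := by
  obtain ⟨r, rfl⟩ : ∃ r, k = r + 1 := ⟨k - 1, by omega⟩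
  set h : ℝ := 1 / (2 * (4 ^ r + 1)) with hh
  have hpos : 0 < h := by positivity
  have hh1 : h * (4 ^ r + 1) = 1 / 2 := by rw [hh]; field_simp
  have hle : h ≤ 1 := by nlinarith [show (0 : ℝ) < 4 ^ r by positivity]
  obtain ⟨i, hi⟩ := exists_nat_gt (1 / (h * (η / 2) ^ (r + 1)))
  rw [div_lt_iff₀ (by positivity)] at hi
  obtain ⟨ε₀, hε₀, herr⟩ := exists_survivalError_le r i 1 (half_pos hη)
  refine ⟨ε₀, hε₀, fun ε hε hεle => ⟨0, fun n _ H hcard w ⟨hw, _, hdeg⟩ hdeg' hcodeg => ?_⟩⟩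
  obtain ⟨N, hN⟩ := exists_nat_gt (1 + h / ε + h * ∑ e ∈ H, w e)
  have hW : 0 ≤ h * ∑ e ∈ H, w e := mul_nonneg hpos.le (sum_nonneg fun e _ => hw e)
  have hhε : 0 ≤ h / ε := by positivity
  have hN0 : (0 : ℝ) < N := by linarith
  have hτ : 0 ≤ h / N := by positivity
  have hτ1 : h / N ≤ 1 := by rw [div_le_one hN0]; linarith
  have hτε : h / N ≤ ε := by rw [div_le_comm₀ hN0 hε]; linarith
  have hτw : h / N * ∑ e ∈ H, w e < 1 := by
    rw [div_mul_eq_mul_div, div_lt_one hN0]; linarith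
  have hNτ : N * (h / N) = h := by field_simp
  have hprob (v : Fin n) : uncoveredProb H w (h / N) {v} (i * N) ≤ η := by
    have h1 := abs_uncoveredProb_sub_le hcard hw hε.le hdeg hdeg' hcodeg hτ hτ1 hτε hτw {v} (i * N)
    have h2 := herr ε hε.le hεle (h / N) hτ N (by rw [hNτ, hh1]) 1 le_rfl
    rw [card_singleton, pow_one] at h1
    have h3 : survival r (h / N) (i * N) ≤ η / 2 := by
      refine (survival_le_or hτ hτ1 (half_pos hη).le (i * N)).resolve_right fun h4 => ?_
      have h5 := (survival_mem (r := r) hτ hτ1 (i * N)).1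
      push_cast at h4
      rw [mul_assoc (i : ℝ), hNτ] at h4
      linarith
    linarith [(abs_le.1 h1).2]
  obtain ⟨M, hMH, hM, hMle⟩ := exists_matching_le_greedyStep_pow hw hτ hτw
    (∑ v, uncoveredInd {v}) (i * N) (M := ∅) (empty_subset H) (by simp)
  refine ⟨M, hMH, hM, ?_⟩
  have hsum : (greedyStep H w (h / N) ^ (i * N)) (∑ v, uncoveredInd {v})
      (univ \ (∅ : Finset _).biUnion id) ≤ n * η := by
    rw [map_sum, Finset.sum_apply, biUnion_empty, sdiff_empty]
    refine (sum_le_sum fun v _ => hprob v).trans ?_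
    simp
  have hcount : (∑ v, uncoveredInd {v}) (univ \ M.biUnion id) = (n : ℝ) - #M * (r + 1) := by
    have h1 : #(M.biUnion id) = #M * (r + 1) := by
      rw [card_biUnion hM]
      exact sum_const_nat fun e he => hcard e (hMH he)
    have h2 := card_sdiff_add_card_eq_card (subset_univ (M.biUnion id))
    rw [h1, card_univ, Fintype.card_fin] at h2
    have h3 : (∑ v, uncoveredInd {v}) (univ \ M.biUnion id) = (#(univ \ M.biUnion id) : ℝ) := by
      simp only [Finset.sum_apply, uncoveredInd, singleton_subset_iff, sum_boole, filter_univ_mem]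
    have h4 : (#(univ \ M.biUnion id) : ℝ) + #M * (r + 1) = n := by exact_mod_cast h2
    linarith
  rw [div_le_iff₀ (by positivity)]
  push_cast
  linarith
end

section
/- Suppose 1/n ≪ η, α ≪ γ, 1/k with k dividing n, and let H be a k-uniform hypergraph on n vertices with δ⁺(H) ≥ ((k−1)/k)·n − αn and no isolated vertices. Then either H is γ-extremal or H contains a matching of size at least (1−η)·n/k. -/
open Finset

variable {V : Type*} [Fintype V] [DecidableEq V]

/-- `H` (a hypergraph on vertex set `V`) is `γ`-extremal: there is a set `S` of
`|V|/k` vertices such that at most `γ |V|^k` edges have at least two vertices in `S`. -/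
def IsExtremal (k : ℕ) (γ : ℝ) (H : Finset (Finset V)) : Prop :=
  ∃ S : Finset V, S.card = Fintype.card V / k ∧
    ((H.filter fun e => 2 ≤ (e ∩ S).card).card : ℝ) ≤ γ * (Fintype.card V : ℝ) ^ k

/-- The density form of the power mean inequality over a finite type. -/
lemma mean_pow_le_mean_pow {Y : Type*} [Fintype Y] [Nonempty Y] (f : Y → ℝ)
    (hf : ∀ y, 0 ≤ f y) (q : ℕ) :
    ((∑ y, f y) / Fintype.card Y) ^ q ≤ (∑ y, f y ^ q) / Fintype.card Y := by
  have hY : (0 : ℝ) < Fintype.card Y := by exact_mod_cast Fintype.card_pos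
  have h := Real.pow_arith_mean_le_arith_mean_pow univ
    (fun _ : Y => (1 : ℝ) / Fintype.card Y) f (fun _ _ => by positivity)
    (by simp [hY.ne']) (fun y _ => hf y) q
  rw [← mul_sum, ← mul_sum] at h
  calc _ = (1 / (Fintype.card Y : ℝ) * ∑ y, f y) ^ q := by ring
    _ ≤ _ := h
    _ = _ := by ring

/-- Every set `G` of `t`-tuples contains at least the expected number of (possibly degenerate)
complete `t`-partite blow-ups with parts of size `b`. -/
lemma density_pow_le_blowup_density (X : Type*) [Fintype X] [Nonempty X] (b t : ℕ) :
    ∀ G : Set (Fin t → X), ((Nat.card G : ℝ) / (Fintype.card X : ℝ) ^ t) ^ (b ^ t) ≤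
      (Nat.card {B : Fin t → Fin b → X | ∀ c : Fin t → Fin b, (fun j => B j (c j)) ∈ G} : ℝ) /
        (Fintype.card X : ℝ) ^ (t * b) := by
  classical
  have hX : (0 : ℝ) < Fintype.card X := by exact_mod_cast Fintype.card_pos
  have key : ∀ {Y : Type _} [Fintype Y] (S : Set Y),
      (Nat.card S : ℝ) = ∑ y, if y ∈ S then (1 : ℝ) else 0 := by
    intro Y _ S
    rw [Nat.card_eq_fintype_card, Fintype.card_subtype]
    simp
  induction t with
  | zero =>
    intro G
    simp only [pow_zero, pow_one, div_one, zero_mul]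
    have e : {B : Fin 0 → Fin b → X | ∀ c : Fin 0 → Fin b, (fun j => B j (c j)) ∈ G}
        = {B | (fun j => j.elim0 : Fin 0 → X) ∈ G} := by
      ext B
      have : ∀ f : Fin 0 → X, f = fun j => j.elim0 := fun f => Subsingleton.elim _ _
      simp [this]
    rw [e, key, key, Fintype.sum_unique, Fintype.sum_unique,
      Subsingleton.elim (default : Fin 0 → X) (fun j => j.elim0)]
    simp
  | succ t ih =>
    intro G
    set N : ℝ := (Fintype.card X : ℝ) with hN
    let Gx : (Fin b → X) → Set (Fin t → X) :=
      fun x => {y | ∀ i, (Fin.cons (x i) y : Fin (t + 1) → X) ∈ G}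
    have hcnt : (Nat.card {B : Fin (t + 1) → Fin b → X |
        ∀ c : Fin (t + 1) → Fin b, (fun j => B j (c j)) ∈ G} : ℝ) =
        ∑ x : Fin b → X, (Nat.card {B : Fin t → Fin b → X |
          ∀ c : Fin t → Fin b, (fun j => B j (c j)) ∈ Gx x} : ℝ) := by
      simp only [key]
      rw [← (Fin.consEquiv (fun _ : Fin (t + 1) => (Fin b → X))).sum_comp, Fintype.sum_prod_type]
      refine sum_congr rfl fun x _ => sum_congr rfl fun B _ => ?_
      congr 1
      simp only [Fin.consEquiv, Equiv.coe_fn_mk, Set.mem_ofPred_eq, Gx, eq_iff_iff]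
      constructor
      · intro h c i
        convert h (Fin.cons i c) using 1
        ext j
        refine Fin.cases ?_ (fun j => ?_) j <;> simp
      · intro h c
        convert h (Fin.tail c) (c 0) using 1
        ext j
        refine Fin.cases ?_ (fun j => ?_) j <;> simp [Fin.tail]
    have hfst : ∑ x : Fin b → X, (Nat.card (Gx x) : ℝ) =
        ∑ y : Fin t → X,
          (∑ x : X, if (Fin.cons x y : Fin (t + 1) → X) ∈ G then (1 : ℝ) else 0) ^ b := by
      simp only [key]
      rw [sum_comm]
      refine sum_congr rfl fun y _ => ?_
      rw [Fintype.sum_pow]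
      refine sum_congr rfl fun x _ => ?_
      rw [prod_ite_zero]
      simp [Gx]
    have hG : (Nat.card G : ℝ) = ∑ y : Fin t → X,
        ∑ x : X, if (Fin.cons x y : Fin (t + 1) → X) ∈ G then (1 : ℝ) else 0 := by
      rw [key, ← (Fin.consEquiv (fun _ : Fin (t + 1) => X)).sum_comp, Fintype.sum_prod_type,
        sum_comm]
      rfl
    have h1 := mean_pow_le_mean_pow (fun y : Fin t → X =>
      (∑ x : X, if (Fin.cons x y : Fin (t + 1) → X) ∈ G then (1 : ℝ) else 0))
      (fun y => sum_nonneg fun x _ => by split_ifs <;> norm_num) b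
    have h2 := mean_pow_le_mean_pow (fun x : Fin b → X => (Nat.card (Gx x) : ℝ) / N ^ t)
      (fun y => by positivity) (b ^ t)
    rw [← hG, ← hfst] at h1
    simp only [Fintype.card_fun, Fintype.card_fin, Nat.cast_pow, ← hN] at h1 h2
    have h3 : ∑ x : Fin b → X, ((Nat.card (Gx x) : ℝ) / N ^ t) ^ (b ^ t) ≤
        ∑ x : Fin b → X, (Nat.card {B : Fin t → Fin b → X |
          ∀ c : Fin t → Fin b, (fun j => B j (c j)) ∈ Gx x} : ℝ) / N ^ (t * b) :=
      sum_le_sum fun x _ => ih (Gx x)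
    rw [hcnt]
    calc ((Nat.card G : ℝ) / N ^ (t + 1)) ^ (b ^ (t + 1))
        = (((Nat.card G : ℝ) / N ^ t) ^ b / N ^ b) ^ (b ^ t) := by
          rw [← div_pow, ← pow_mul, div_div, ← pow_succ, pow_succ b, mul_comm b]
      _ ≤ ((∑ x : Fin b → X, (Nat.card (Gx x) : ℝ)) / N ^ t / N ^ b) ^ (b ^ t) := by
          gcongr
      _ = ((∑ x : Fin b → X, (Nat.card (Gx x) : ℝ) / N ^ t) / N ^ b) ^ (b ^ t) := by
          rw [sum_div]
      _ ≤ _ := h2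
      _ ≤ _ := div_le_div_of_nonneg_right h3 (by positivity)
      _ = _ := by
          rw [← sum_div, div_div, ← pow_add]
          congr 2
          ring

/-- A dense set of `ι`-tuples over a large set contains a complete blow-up with disjoint parts. -/
lemma exists_injective_blowup (ι : Type*) [Fintype ι] (b : ℕ) (d : ℝ) (hd : 0 < d) :
    ∃ N₀ : ℕ, ∀ (X : Type) [Fintype X], N₀ ≤ Fintype.card X → ∀ G : Set (ι → X),
      d * (Fintype.card X : ℝ) ^ Fintype.card ι ≤ (Nat.card G : ℝ) →
      ∃ B : ι → Fin b → X, (∀ i j a a', B i a = B j a' → i = j ∧ a = a') ∧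
        ∀ c : ι → Fin b, (fun j => B j (c j)) ∈ G := by
  classical
  set t := Fintype.card ι with ht
  set m := t * b with hm
  obtain ⟨N₀, hN₀⟩ := exists_nat_gt ((m * m : ℝ) / d ^ (b ^ t))
  refine ⟨N₀ + m + 1, fun X _ hX G hG => ?_⟩
  have hXpos : 0 < Fintype.card X := by omega
  have : Nonempty X := Fintype.card_pos_iff.mp hXpos
  set N : ℝ := (Fintype.card X : ℝ) with hN
  have hNpos : 0 < N := Nat.cast_pos.mpr hXpos
  let e : ι ≃ Fin t := Fintype.equivFin ι
  let G' : Set (Fin t → X) := {f | f ∘ e ∈ G}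
  have hcard : Nat.card G' = Nat.card G := by
    refine Nat.card_congr ?_
    exact (Equiv.arrowCongr e.symm (Equiv.refl X)).subtypeEquiv (fun f => by
      simp [G', Equiv.arrowCongr, Function.comp_def])
  have hdens := density_pow_le_blowup_density X b t G'
  rw [hcard] at hdens
  have h1 : d ≤ (Nat.card G : ℝ) / N ^ t := by rwa [le_div_iff₀ (by positivity)]
  have h2 : d ^ (b ^ t) * N ^ m ≤ (Nat.card {B : Fin t → Fin b → X |
      ∀ c : Fin t → Fin b, (fun j => B j (c j)) ∈ G'} : ℝ) := by
    rw [← le_div_iff₀ (by positivity)]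
    exact (pow_le_pow_left₀ hd.le h1 _).trans hdens
  have hinj : N ^ m - (m * m) * N ^ m / N ≤
      (Nat.card {B : Fin t → Fin b → X | Function.Injective (Function.uncurry B)} : ℝ) := by
    have e1 : Nat.card {B : Fin t → Fin b → X | Function.Injective (Function.uncurry B)} =
        (Fintype.card X).descFactorial m := by
      have h0 : m = Fintype.card (Fin t × Fin b) := by simp [hm]
      rw [h0, ← Fintype.card_embedding_eq, ← Nat.card_eq_fintype_card (α := Fin t × Fin b ↪ X)]
      refine Nat.card_congr (Equiv.trans ?_
        (Equiv.subtypeInjectiveEquivEmbedding (Fin t × Fin b) X))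
      exact (Equiv.curry (Fin t) (Fin b) X).symm.subtypeEquiv
        (p := fun B => B ∈ {B : Fin t → Fin b → X | Function.Injective (Function.uncurry B)})
        (q := fun f => Function.Injective f) (fun B => Iff.rfl)
    rw [e1]
    have h3 : ((Fintype.card X - m : ℕ) : ℝ) ^ m ≤ ((Fintype.card X).descFactorial m : ℝ) := by
      have := Nat.pow_sub_le_descFactorial (Fintype.card X) m
      have h4 : (Fintype.card X - m) ^ m ≤ (Fintype.card X + 1 - m) ^ m :=
        Nat.pow_le_pow_left (by omega) _
      exact_mod_cast h4.trans this
    refine le_trans ?_ h3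
    rw [Nat.cast_sub (by omega), ← hN]
    have hmN : (m : ℝ) / N ≤ 1 := by
      rw [div_le_one hNpos]
      have : (m : ℝ) ≤ Fintype.card X := by exact_mod_cast (by omega : m ≤ Fintype.card X)
      exact this
    have h5 := one_add_mul_le_pow (a := -((m : ℝ) / N)) (by linarith) m
    have h6 : (N - m) ^ m = N ^ m * (1 + -((m : ℝ) / N)) ^ m := by
      rw [← mul_pow]
      congr 1
      field_simp
      ring
    rw [h6]
    calc _ = N ^ m * (1 + m * -((m : ℝ) / N)) := by ring
      _ ≤ _ := by gcongr
  have hlt : (m * m) * N ^ m / N < d ^ (b ^ t) * N ^ m := by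
    have : (m * m : ℝ) / d ^ (b ^ t) < N := by
      refine hN₀.trans_le ?_
      have : (N₀ : ℝ) ≤ Fintype.card X := by exact_mod_cast (by omega : N₀ ≤ Fintype.card X)
      exact this
    rw [div_lt_iff₀ (by positivity)] at this ⊢
    have := mul_lt_mul_of_pos_right this (pow_pos hNpos m)
    linarith
  by_contra hno
  push Not at hno
  have hdisj : Disjoint {B : Fin t → Fin b → X |
      ∀ c : Fin t → Fin b, (fun j => B j (c j)) ∈ G'}
      {B : Fin t → Fin b → X | Function.Injective (Function.uncurry B)} := by
    rw [Set.disjoint_left]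
    intro B hB hBi
    obtain ⟨c, hc⟩ := hno (fun i => B (e i)) (fun i j a a' h => by
      have := @hBi (e i, a) (e j, a') h
      simpa using this)
    apply hc
    have := hB (fun j => c (e.symm j))
    simpa [G', Function.comp_def] using this
  have htot := Set.ncard_union_eq hdisj (Set.toFinite _) (Set.toFinite _)
  have hle := Set.ncard_le_card ({B : Fin t → Fin b → X |
      ∀ c : Fin t → Fin b, (fun j => B j (c j)) ∈ G'} ∪
      {B : Fin t → Fin b → X | Function.Injective (Function.uncurry B)})
  rw [htot] at hle
  rw [Nat.card_coe_set_eq] at h2 hinj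
  have h7 : (Nat.card (Fin t → Fin b → X) : ℝ) = N ^ m := by
    simp [hN, hm, ← pow_mul, mul_comm]
  have h8 : (({B : Fin t → Fin b → X |
      ∀ c : Fin t → Fin b, (fun j => B j (c j)) ∈ G'}.ncard : ℝ)) +
      ({B : Fin t → Fin b → X | Function.Injective (Function.uncurry B)}.ncard : ℝ) ≤ N ^ m := by
    rw [← h7]
    exact_mod_cast hle
  linarith

/-- If `z` has mean zero conditionally on its `i`-th coordinate, then `φ ↦ z (φ ∘ ρ)` is
orthogonal to every `Q` not depending on the coordinates `ρ m` with `m ≠ i`. -/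
lemma sum_mul_eq_zero_of_marginal {ι κ X : Type*} [Fintype ι] [DecidableEq ι] [Fintype κ]
    [DecidableEq κ] [Fintype X] [DecidableEq X] (ρ : κ → ι) (hρ : Function.Injective ρ) (i : κ)
    (z : (κ → X) → ℝ) (hz : ∀ c, ∑ ψ with ψ i = c, z ψ = 0) (Q : (ι → X) → ℝ)
    (hQ : ∀ φ φ' : ι → X, (∀ j, (∀ m, m ≠ i → ρ m ≠ j) → φ j = φ' j) → Q φ = Q φ') :
    ∑ φ : ι → X, z (φ ∘ ρ) * Q φ = 0 := by
  classical
  let p : ι → Prop := fun j => ∃ m, m ≠ i ∧ ρ m = j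
  let e := Equiv.piEquivPiSubtypeProd p (fun _ => X)
  have he1 : ∀ a b m, (hm : m ≠ i) → e.symm (a, b) (ρ m) = a ⟨ρ m, m, hm, rfl⟩ := by
    intro a b m hm
    have : p (ρ m) := ⟨m, hm, rfl⟩
    simp [e, Equiv.piEquivPiSubtypeProd, this]
  have he2 : ∀ a b j, (hj : ¬ p j) → e.symm (a, b) j = b ⟨j, hj⟩ := by
    intro a b j hj
    simp [e, Equiv.piEquivPiSubtypeProd, hj]
  have hi : ¬ p (ρ i) := by
    rintro ⟨m, hm, h⟩
    exact hm (hρ h)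
  rw [← e.symm.sum_comp, Fintype.sum_prod_type, sum_comm]
  refine sum_eq_zero fun b _ => ?_
  rcases isEmpty_or_nonempty ({j // p j} → X) with hemp | ⟨⟨a₀⟩⟩
  · simp
  have hQc : ∀ a, Q (e.symm (a, b)) = Q (e.symm (a₀, b)) := by
    intro a
    refine hQ _ _ fun j hj => ?_
    have : ¬ p j := by
      rintro ⟨m, hm, h⟩
      exact hj m hm h
    rw [he2 _ _ _ this, he2 _ _ _ this]
  simp_rw [hQc, ← sum_mul]
  convert zero_mul _
  rw [← hz (b ⟨ρ i, hi⟩)]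
  refine sum_bij (fun a _ => e.symm (a, b) ∘ ρ) ?_ ?_ ?_ ?_
  · intro a _
    simp [he2 _ _ _ hi]
  · intro a _ a' _ h
    ext ⟨j, m, hm, rfl⟩
    have := congrFun h m
    simpa [he1 _ _ m hm] using this
  · intro ψ hψ
    refine ⟨fun j => ψ j.2.choose, mem_univ _, ?_⟩
    ext m
    by_cases hm : m = i
    · subst hm
      simp only [mem_filter, mem_univ, true_and] at hψ
      simp [he2 _ _ _ hi, hψ]
    · simp only [Function.comp_apply]
      rw [he1 _ _ m hm]
      congr 1
      exact hρ (Exists.choose_spec (⟨m, hm, rfl⟩ : p (ρ m))).2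
  · intro a _
    rfl

/-- Second moment bound for an average of copies of `h` along index maps which pairwise meet only
in the image of `i`. -/
lemma sum_sq_average_sub_one_le {ι κ X L : Type*} [Fintype ι] [DecidableEq ι] [Fintype κ]
    [DecidableEq κ] [Fintype X] [DecidableEq X] [DecidableEq L] (Λ : Finset L) (ρ : L → κ → ι)
    (hρ : ∀ ℓ, Function.Injective (ρ ℓ)) (i : κ)
    (hd : ∀ ℓ ∈ Λ, ∀ ℓ' ∈ Λ, ℓ ≠ ℓ' → ∀ m, m ≠ i → ∀ m', ρ ℓ m ≠ ρ ℓ' m')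
    (hΛ : Λ.Nonempty) (h : (κ → X) → ℝ) (C : ℝ) (h0 : ∀ ψ, 0 ≤ h ψ) (hC : ∀ ψ, h ψ ≤ C)
    (hm : ∀ c, ∑ ψ with ψ i = c, (h ψ - 1) = 0) :
    ∑ φ : ι → X, ((∑ ℓ ∈ Λ, h (φ ∘ ρ ℓ)) / Λ.card - 1) ^ 2 ≤
      C / Λ.card * (Fintype.card X : ℝ) ^ Fintype.card ι := by
  have hcard : (0 : ℝ) < Λ.card := by exact_mod_cast hΛ.card_pos
  have horth : ∀ ℓ ∈ Λ, ∀ ℓ' ∈ Λ, ℓ ≠ ℓ' →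
      ∑ φ : ι → X, (h (φ ∘ ρ ℓ) - 1) * (h (φ ∘ ρ ℓ') - 1) = 0 := by
    intro ℓ hℓ ℓ' hℓ' hne
    refine sum_mul_eq_zero_of_marginal (ρ ℓ) (hρ ℓ) i (fun ψ => h ψ - 1) hm
      (fun φ => h (φ ∘ ρ ℓ') - 1) fun φ φ' hφ => ?_
    have : φ ∘ ρ ℓ' = φ' ∘ ρ ℓ' := by
      ext m'
      exact hφ _ fun m hmi => hd ℓ hℓ ℓ' hℓ' hne m hmi m'
    simp only [this]
  have hone : ∀ ℓ, ∑ φ : ι → X, (h (φ ∘ ρ ℓ) - 1) = 0 := by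
    intro ℓ
    have := sum_mul_eq_zero_of_marginal (ρ ℓ) (hρ ℓ) i (fun ψ => h ψ - 1) hm (fun _ => 1)
      fun _ _ _ => rfl
    simpa using this
  have hdiag : ∀ ℓ, ∑ φ : ι → X, (h (φ ∘ ρ ℓ) - 1) * (h (φ ∘ ρ ℓ) - 1) ≤
      C * (Fintype.card X : ℝ) ^ Fintype.card ι := by
    intro ℓ
    have hpt : ∀ φ : ι → X, (h (φ ∘ ρ ℓ) - 1) * (h (φ ∘ ρ ℓ) - 1) ≤
        (C - 2) * (h (φ ∘ ρ ℓ) - 1) + (C - 1) := by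
      intro φ
      nlinarith [h0 (φ ∘ ρ ℓ), hC (φ ∘ ρ ℓ)]
    refine (sum_le_sum fun φ _ => hpt φ).trans ?_
    rw [sum_add_distrib, ← mul_sum, hone]
    simp only [mul_zero, sum_const, card_univ, Fintype.card_fun, nsmul_eq_mul, zero_add,
      Nat.cast_pow]
    have : (0 : ℝ) ≤ (Fintype.card X : ℝ) ^ Fintype.card ι := by positivity
    nlinarith
  have hexp : ∀ φ : ι → X, ((∑ ℓ ∈ Λ, h (φ ∘ ρ ℓ)) / Λ.card - 1) ^ 2 =
      (∑ ℓ ∈ Λ, ∑ ℓ' ∈ Λ, (h (φ ∘ ρ ℓ) - 1) * (h (φ ∘ ρ ℓ') - 1)) / (Λ.card : ℝ) ^ 2 := by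
    intro φ
    rw [← sum_mul_sum, sum_sub_distrib]
    simp only [sum_const, nsmul_eq_mul, mul_one]
    field_simp
  simp_rw [hexp, ← sum_div]
  rw [sum_comm]
  have : ∑ ℓ ∈ Λ, ∑ φ : ι → X, ∑ ℓ' ∈ Λ, (h (φ ∘ ρ ℓ) - 1) * (h (φ ∘ ρ ℓ') - 1) ≤
      ∑ ℓ ∈ Λ, C * (Fintype.card X : ℝ) ^ Fintype.card ι := by
    refine sum_le_sum fun ℓ hℓ => ?_
    rw [sum_comm, sum_eq_single_of_mem ℓ hℓ]
    · exact hdiag ℓ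
    · intro ℓ' hℓ' hne
      exact horth ℓ hℓ ℓ' hℓ' hne.symm
  calc _ ≤ (∑ ℓ ∈ Λ, C * (Fintype.card X : ℝ) ^ Fintype.card ι) / (Λ.card : ℝ) ^ 2 := by
        gcongr
    _ = _ := by
        rw [sum_const, nsmul_eq_mul]
        field_simp

lemma one_sub_prod_le_sum_one_sub {P : Type*} (s : Finset P) (f : P → ℝ) (h0 : ∀ p, 0 ≤ f p)
    (h1 : ∀ p, f p ≤ 1) : 1 - ∏ p ∈ s, f p ≤ ∑ p ∈ s, (1 - f p) := by
  classical
  induction s using Finset.induction_on with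
  | empty => simp
  | insert a s ha ih =>
    rw [prod_insert ha, sum_insert ha]
    have : ∏ p ∈ s, f p ≤ 1 := prod_le_one (fun p _ => h0 p) fun p _ => h1 p
    nlinarith [h0 a, h1 a]

/-- An edge weighting can be decreased to a fractional matching at a cost of at most the total
excess of the weighted degrees over `1`. -/
lemma exists_capped_weight {E P : Type*} [Fintype E] [Fintype P] [DecidableEq P]
    (inc : E → Finset P) (x : E → ℝ) (hx : ∀ e, 0 ≤ x e) :
    ∃ y : E → ℝ, (∀ e, 0 ≤ y e) ∧ (∀ e, y e ≤ x e) ∧ (∀ p, ∑ e with p ∈ inc e, y e ≤ 1) ∧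
      ∑ e, x e - ∑ p, max (∑ e with p ∈ inc e, x e - 1) 0 ≤ ∑ e, y e := by
  set d : P → ℝ := fun p => ∑ e with p ∈ inc e, x e with hd
  have hd0 : ∀ p, 0 ≤ d p := fun p => sum_nonneg fun e _ => hx e
  set s : P → ℝ := fun p => 1 / max 1 (d p) with hs
  have hmax : ∀ p, 0 < max 1 (d p) := fun p => lt_max_of_lt_left one_pos
  have hs0 : ∀ p, 0 ≤ s p := fun p => (one_div_pos.mpr (hmax p)).le
  have hs1 : ∀ p, s p ≤ 1 := fun p => by
    simp only [hs]
    rw [div_le_one (hmax p)]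
    exact le_max_left _ _
  refine ⟨fun e => x e * ∏ p ∈ inc e, s p,
    fun e => mul_nonneg (hx e) (prod_nonneg fun p _ => hs0 p),
    fun e => mul_le_of_le_one_right (hx e) (prod_le_one (fun p _ => hs0 p) fun p _ => hs1 p),
    fun p => ?_, ?_⟩
  · calc ∑ e with p ∈ inc e, x e * ∏ q ∈ inc e, s q ≤ ∑ e with p ∈ inc e, x e * s p := by
          refine sum_le_sum fun e he => mul_le_mul_of_nonneg_left ?_ (hx e)
          simp only [mem_filter, mem_univ, true_and] at he
          rw [← mul_prod_erase _ _ he]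
          exact mul_le_of_le_one_right (hs0 p) (prod_le_one (fun p _ => hs0 p) fun p _ => hs1 p)
      _ = d p * s p := by rw [← sum_mul]
      _ = d p / max 1 (d p) := by rw [hs]; ring
      _ ≤ 1 := by
        rw [div_le_one (hmax p)]
        exact le_max_right _ _
  · have h1 : ∀ e, x e - x e * ∏ p ∈ inc e, s p ≤ ∑ p ∈ inc e, x e * (1 - s p) := by
      intro e
      rw [← mul_sum]
      have := mul_le_mul_of_nonneg_left
        (one_sub_prod_le_sum_one_sub (inc e) s hs0 hs1) (hx e)
      linarith
    have h2 : ∑ e, ∑ p ∈ inc e, x e * (1 - s p) = ∑ p, d p * (1 - s p) := by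
      have : ∀ e, ∑ p ∈ inc e, x e * (1 - s p) =
          ∑ p, if p ∈ inc e then x e * (1 - s p) else 0 := by
        intro e
        simp
      simp_rw [this]
      rw [sum_comm]
      refine sum_congr rfl fun p _ => ?_
      rw [← sum_filter, sum_mul]
    have h3 : ∀ p, d p * (1 - s p) = max (d p - 1) 0 := by
      intro p
      simp only [hs]
      rcases le_total (d p) 1 with h | h
      · rw [max_eq_left h, max_eq_right (by linarith)]
        simp
      · rw [max_eq_right h, max_eq_left (by linarith)]
        field_simp
    have h4 := sum_le_sum fun e (_ : e ∈ univ) => h1 e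
    rw [h2, sum_sub_distrib] at h4
    simp_rw [h3] at h4
    linarith

lemma exists_injOn_fin {α : Type*} [DecidableEq α] (S : Finset α) (b : ℕ) (hb : 0 < b)
    (hS : S.card ≤ b) : ∃ f : α → Fin b, Set.InjOn f S := by
  refine ⟨fun s => if h : s ∈ S then Fin.castLE hS (S.equivFin ⟨s, h⟩) else ⟨0, hb⟩, ?_⟩
  intro s hs s' hs' h
  have h1 : s ∈ S := hs
  have h2 : s' ∈ S := hs'
  simpa [h1, h2] using h

/-- An integral weighting `c` of patterns with degrees at most `b` yields a matching of size
`∑ c` inside a complete blow-up with parts of size `b`. -/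
lemma exists_matching_of_blowup {ι X E : Type*} [Fintype ι] [DecidableEq ι] [DecidableEq X]
    [Fintype E] [DecidableEq E] {k b : ℕ} (hk : 0 < k) (hb : 0 < b)
    (H : Finset (Finset (X × Fin k))) (B : ι → Fin b → X)
    (hB : ∀ i j a a', B i a = B j a' → i = j ∧ a = a')
    (idx : E → Fin k → ι) (slot : E → Fin k → Fin k) (c : E → ℕ)
    (hH : ∀ e, c e ≠ 0 → ∀ a : Fin k → Fin b,
      univ.image (fun l => (B (idx e l) (a l), slot e l)) ∈ H)
    (hc : ∀ p : ι × Fin k,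
      ∑ e with p ∈ univ.image (fun l => (idx e l, slot e l)), c e ≤ b) :
    ∃ M ⊆ H, (M : Set (Finset (X × Fin k))).PairwiseDisjoint id ∧ M.card = ∑ e, c e ∧
      ∀ f ∈ M, ∀ x ∈ f, ∃ j a, x.1 = B j a := by
  classical
  have hemb : ∀ p : ι × Fin k, ∃ f : (Σ e : E, Fin (c e)) → Fin b,
      Set.InjOn f {s | p ∈ univ.image (fun l => (idx s.1 l, slot s.1 l))} := by
    intro p
    obtain ⟨f, hf⟩ := exists_injOn_fin
      ((univ : Finset E).filter (fun e => p ∈ univ.image (fun l => (idx e l, slot e l)))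
        |>.sigma fun e => (univ : Finset (Fin (c e)))) b hb (by
        rw [card_sigma]
        simpa using hc p)
    refine ⟨f, hf.mono ?_⟩
    intro s hs
    simpa using hs
  choose emb hemb using hemb
  let F : (Σ e : E, Fin (c e)) → Finset (X × Fin k) := fun s =>
    univ.image (fun l => (B (idx s.1 l) (emb (idx s.1 l, slot s.1 l) s), slot s.1 l))
  have hF : ∀ s s' x, x ∈ F s → x ∈ F s' → s = s' := by
    intro s s' x hx hx'
    simp only [F, mem_image, mem_univ, true_and] at hx hx'
    obtain ⟨l, rfl⟩ := hx
    obtain ⟨l', hl'⟩ := hx'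
    rw [Prod.mk.injEq] at hl'
    obtain ⟨h1, h2⟩ := hB _ _ _ _ hl'.1
    rw [h1, hl'.2] at h2
    refine (hemb (idx s.1 l, slot s.1 l) ?_ ?_ h2).symm
    · simp only [Set.mem_ofPred_eq, mem_image, mem_univ, true_and]
      exact ⟨l', by rw [h1, hl'.2]⟩
    · simp only [Set.mem_ofPred_eq, mem_image, mem_univ, true_and]
      exact ⟨l, rfl⟩
  have hne : ∀ s, (F s).Nonempty := fun s => ⟨_, mem_image_of_mem _ (mem_univ ⟨0, hk⟩)⟩
  have hinj : Function.Injective F := by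
    intro s s' h
    obtain ⟨x, hx⟩ := hne s
    exact hF s s' x hx (h ▸ hx)
  refine ⟨univ.image F, ?_, ?_, ?_, ?_⟩
  · intro f hf
    simp only [mem_image, mem_univ, true_and] at hf
    obtain ⟨s, rfl⟩ := hf
    refine hH s.1 ?_ _
    have := s.2.2
    omega
  · intro f hf g hg hfg
    simp only [coe_image, coe_univ, Set.image_univ, Set.mem_range] at hf hg
    obtain ⟨s, rfl⟩ := hf
    obtain ⟨s', rfl⟩ := hg
    refine disjoint_left.mpr fun x hx hx' => hfg ?_
    rw [hF s s' x hx hx']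
  · rw [card_image_of_injective _ hinj]
    simp
  · intro f hf x hx
    simp only [mem_image, mem_univ, true_and] at hf
    obtain ⟨s, rfl⟩ := hf
    simp only [F, mem_image, mem_univ, true_and] at hx
    obtain ⟨l, rfl⟩ := hx
    exact ⟨_, _, rfl⟩

lemma card_filter_apply_eq {ι X : Type*} [Fintype ι] [DecidableEq ι] [Fintype X] [DecidableEq X]
    (i : ι) (c : X) :
    (univ.filter fun φ : ι → X => φ i = c).card = Fintype.card X ^ (Fintype.card ι - 1) := by
  have h : Fintype.card {m // m ≠ i} = Fintype.card ι - 1 := by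
    simp [Fintype.card_subtype_compl]
  rw [← h, ← Fintype.card_fun, card_filter, ← (Equiv.funSplitAt i X).symm.sum_comp,
    Fintype.sum_prod_type]
  simp only [Equiv.funSplitAt, Equiv.piSplitAt, Equiv.coe_fn_symm_mk, dite_true]
  rw [sum_comm]
  simp

lemma card_filter_apply_mem {ι X : Type*} [Fintype ι] [DecidableEq ι] [Fintype X] [DecidableEq X]
    (i : ι) (I : Finset X) :
    (univ.filter fun φ : ι → X => φ i ∈ I).card =
      I.card * Fintype.card X ^ (Fintype.card ι - 1) := by
  have h : (univ.filter fun φ : ι → X => φ i ∈ I) =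
      I.biUnion fun c => univ.filter fun φ : ι → X => φ i = c := by
    ext φ
    simp
  rw [h, card_biUnion]
  · simp_rw [card_filter_apply_eq]
    simp
  · intro c _ c' _ hne
    refine disjoint_left.mpr fun φ h1 h2 => hne ?_
    simp only [mem_filter, mem_univ, true_and] at h1 h2
    rw [← h1, h2]

/-- There are `k`-partite linear `D`-regular patterns, with `D` arbitrarily large. -/
lemma exists_linear_pattern (k D₀ : ℕ) (hk : 0 < k) :
    ∃ (ι L : Type) (_ : Fintype ι) (_ : DecidableEq ι) (_ : Fintype L) (_ : DecidableEq L)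
      (D : ℕ) (ρ : L → Fin k → ι) (pos : ι → Fin k), Nonempty ι ∧ D₀ ≤ D ∧ 0 < D ∧
      (∀ ℓ l, pos (ρ ℓ l) = l) ∧
      (∀ j, (univ.filter fun ℓ => ρ ℓ (pos j) = j).card = D) ∧
      (∀ ℓ ℓ', ℓ ≠ ℓ' → ∀ i, ρ ℓ i = ρ ℓ' i → ∀ m, m ≠ i → ∀ m', ρ ℓ m ≠ ρ ℓ' m') := by
  obtain ⟨p, hp, hprime⟩ := Nat.exists_infinite_primes (D₀ + k)
  have : Fact p.Prime := ⟨hprime⟩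
  have hcast : ∀ i m : Fin k, ((i : ℕ) : ZMod p) = ((m : ℕ) : ZMod p) → i = m := by
    intro i m h
    rw [ZMod.natCast_eq_natCast_iff'] at h
    rw [Nat.mod_eq_of_lt (by omega), Nat.mod_eq_of_lt (by omega)] at h
    exact Fin.ext h
  refine ⟨Fin k × ZMod p, ZMod p × ZMod p, inferInstance, inferInstance, inferInstance,
    inferInstance, p, fun ℓ l => (l, ℓ.1 + (l : ℕ) * ℓ.2), Prod.fst, ⟨(⟨0, hk⟩, 0)⟩, by omega,
    hprime.pos, fun _ _ => rfl, ?_, ?_⟩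
  · rintro ⟨i, y⟩
    have : (univ.filter fun ℓ : ZMod p × ZMod p =>
        ((i, ℓ.1 + (i : ℕ) * ℓ.2) : Fin k × ZMod p) = (i, y)) =
        univ.image fun b : ZMod p => (y - (i : ℕ) * b, b) := by
      ext ⟨a, b⟩
      simp only [Prod.mk.injEq, true_and, mem_filter, mem_univ, mem_image]
      constructor
      · rintro rfl
        exact ⟨b, by ring, rfl⟩
      · rintro ⟨b', h, rfl⟩
        rw [← h]
        ring
    rw [this, card_image_of_injective]
    · simp [ZMod.card]
    · intro b b' h
      exact (Prod.mk.inj h).2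
  · rintro ⟨a, b⟩ ⟨a', b'⟩ hne i hi m hm m' h
    simp only [Prod.mk.injEq, true_and] at hi h
    obtain ⟨rfl, h⟩ := h
    have h1 : ((i : ℕ) - (m : ℕ) : ZMod p) * (b - b') = 0 := by linear_combination hi - h
    rcases mul_eq_zero.mp h1 with h2 | h2
    · exact hm (hcast i m (sub_eq_zero.mp h2)).symm
    · have hb : b = b' := sub_eq_zero.mp h2
      subst hb
      apply hne
      rw [Prod.mk.injEq]
      exact ⟨by linear_combination hi, rfl⟩

/-- Sampling a linear pattern from a spread perfect fractional matching `g` yields, on average,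
an almost perfect fractional matching. -/
lemma exists_sampled_fractional_matching {ι L X : Type*} [Fintype ι] [DecidableEq ι] [Fintype L]
    [DecidableEq L] [Fintype X] [DecidableEq X] {k D : ℕ} (hk : 0 < k) (hD : 0 < D)
    (ρ : L → Fin k → ι) (pos : ι → Fin k) (hpos : ∀ ℓ l, pos (ρ ℓ l) = l)
    (hreg : ∀ j, (univ.filter fun ℓ => ρ ℓ (pos j) = j).card = D)
    (hlin : ∀ ℓ ℓ', ℓ ≠ ℓ' → ∀ i, ρ ℓ i = ρ ℓ' i → ∀ m, m ≠ i → ∀ m', ρ ℓ m ≠ ρ ℓ' m')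
    (C ε : ℝ) (hε : 0 < ε) (hDε : 4 * (k : ℝ) ^ 2 * (C * k ^ k) ≤ ε ^ 2 * D)
    (g : (Fin k → X × Fin k) → ℝ) (g0 : ∀ v, 0 ≤ g v) (gC : ∀ v, g v ≤ C)
    (gm : ∀ i x, ∑ v with v i = x, g v = (Fintype.card X : ℝ) ^ (k - 1)) :
    ∃ y : (ι → X) → L × (Fin k → Fin k) → ℝ, (∀ φ e, 0 ≤ y φ e) ∧
      (∀ φ e, g (fun l => (φ (ρ e.1 l), e.2 l)) = 0 → y φ e = 0) ∧
      (∀ φ p, ∑ e with p ∈ univ.image (fun l => (ρ e.1 l, e.2 l)), y φ e ≤ 1) ∧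
      (1 - ε) * Fintype.card ι * (Fintype.card X : ℝ) ^ Fintype.card ι ≤
        ∑ φ, ∑ e, y φ e := by
  classical
  set T : ℝ := (Fintype.card ι : ℝ) with hT
  set W : ℝ := (Fintype.card X : ℝ) ^ Fintype.card ι with hW
  have hkR : (0 : ℝ) < k := by exact_mod_cast hk
  have hDR : (0 : ℝ) < D := by exact_mod_cast hD
  let inc : L × (Fin k → Fin k) → Finset (ι × Fin k) :=
    fun e => univ.image (fun l => (ρ e.1 l, e.2 l))
  have hinc : ∀ e j s, (j, s) ∈ inc e ↔ ρ e.1 (pos j) = j ∧ e.2 (pos j) = s := by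
    intro e j s
    simp only [inc, mem_image, mem_univ, true_and, Prod.mk.injEq]
    constructor
    · rintro ⟨l, rfl, rfl⟩
      simp [hpos]
    · rintro ⟨h1, h2⟩
      exact ⟨_, h1, h2⟩
  have hinccard : ∀ e, (inc e).card = k := by
    intro e
    rw [card_image_of_injective]
    · simp
    · intro l l' h
      have := congrArg (fun q => pos q.1) h
      simpa [hpos] using this
  let x : (ι → X) → L × (Fin k → Fin k) → ℝ :=
    fun φ e => g (fun l => (φ (ρ e.1 l), e.2 l)) / D
  have hx : ∀ φ e, 0 ≤ x φ e := fun φ e => div_nonneg (g0 _) hDR.le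
  choose y hy0 hyx hy1 hys using fun φ => exists_capped_weight inc (x φ) (hx φ)
  refine ⟨y, hy0, fun φ e h => ?_, hy1, ?_⟩
  · refine le_antisymm ((hyx φ e).trans ?_) (hy0 φ e)
    simp [x, h]
  let h : Fin k → Fin k → (Fin k → X) → ℝ :=
    fun i s ψ => ∑ σ : Fin k → Fin k with σ i = s, g (fun l => (ψ l, σ l))
  set d : (ι → X) → ι × Fin k → ℝ := fun φ p => ∑ e with p ∈ inc e, x φ e with hd
  have hdeg : ∀ φ j s, d φ (j, s) =
      (∑ ℓ with ρ ℓ (pos j) = j, h (pos j) s (φ ∘ ρ ℓ)) / D := by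
    intro φ j s
    simp only [hd, hinc, x, h, Function.comp_apply]
    rw [← sum_div]
    congr 1
    rw [sum_filter, Fintype.sum_prod_type, sum_filter]
    refine sum_congr rfl fun ℓ _ => ?_
    by_cases hl : ρ ℓ (pos j) = j
    · simp [hl, sum_filter]
    · simp [hl]
  have hh0 : ∀ i s ψ, 0 ≤ h i s ψ := fun i s ψ => sum_nonneg fun σ _ => g0 _
  have hhC : ∀ i s ψ, h i s ψ ≤ C * k ^ k := by
    intro i s ψ
    calc h i s ψ ≤ ∑ σ : Fin k → Fin k, g (fun l => (ψ l, σ l)) :=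
          sum_le_sum_of_subset_of_nonneg (filter_subset _ _) fun σ _ _ => g0 _
      _ ≤ ∑ σ : Fin k → Fin k, C := sum_le_sum fun σ _ => gC _
      _ = C * k ^ k := by simp [mul_comm]
  have hhm : ∀ i s c, ∑ ψ with ψ i = c, (h i s ψ - 1) = 0 := by
    intro i s c
    rw [sum_sub_distrib, sum_const, card_filter_apply_eq, Fintype.card_fin, sub_eq_zero]
    have := gm i (c, s)
    rw [sum_filter, ← (Equiv.arrowProdEquivProdArrow (Fin k) (fun _ => X)
      (fun _ => Fin k)).symm.sum_comp, Fintype.sum_prod_type] at this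
    simp only [nsmul_eq_mul, mul_one, Nat.cast_pow]
    rw [← this, sum_filter]
    refine sum_congr rfl fun ψ _ => ?_
    simp only [h, Equiv.arrowProdEquivProdArrow, Equiv.coe_fn_symm_mk, Prod.mk.injEq]
    by_cases hψ : ψ i = c
    · simp [hψ, sum_filter]
    · simp [hψ]
  have hvar : ∀ p, ∑ φ, (d φ p - 1) ^ 2 ≤ C * k ^ k / D * W := by
    rintro ⟨j, s⟩
    have hΛ : (univ.filter fun ℓ => ρ ℓ (pos j) = j).Nonempty := by
      rw [← card_pos, hreg]
      exact hD
    have := sum_sq_average_sub_one_le (univ.filter fun ℓ => ρ ℓ (pos j) = j) ρ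
      (fun ℓ l l' hl => by
        have := congrArg pos hl
        simpa [hpos] using this)
      (pos j)
      (fun ℓ hℓ ℓ' hℓ' hne m hm m' => hlin ℓ ℓ' hne (pos j) (by
        simp only [mem_filter, mem_univ, true_and] at hℓ hℓ'
        rw [hℓ, hℓ']) m hm m') hΛ (h (pos j) s) (C * k ^ k) (hh0 _ _) (hhC _ _) (hhm _ _)
    rw [hreg] at this
    simpa only [hdeg] using this
  set θ : ℝ := ε / (4 * k) with hθ
  have hθ0 : 0 < θ := by positivity
  have hxsum : ∀ φ, ∑ e, x φ e = (∑ p, d φ p) / k := by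
    intro φ
    rw [eq_div_iff hkR.ne']
    simp only [hd, sum_filter]
    rw [sum_comm, sum_mul]
    refine sum_congr rfl fun e _ => ?_
    rw [← sum_filter, sum_const, filter_mem_eq_inter, univ_inter, hinccard]
    simp [mul_comm]
  have hk1 : (1 : ℝ) ≤ k := by exact_mod_cast hk
  have hbound : ∀ φ, T - ∑ p, 2 * ((d φ p - 1) ^ 2 / (4 * θ) + θ) ≤ ∑ e, y φ e := by
    intro φ
    refine le_trans ?_ (hys φ)
    rw [hxsum]
    have hTk : T = ∑ p : ι × Fin k, (1 : ℝ) / k := by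
      simp only [sum_const, card_univ, Fintype.card_prod, Fintype.card_fin, nsmul_eq_mul]
      push_cast
      field_simp
      simp [hT]
    rw [hTk, sum_div, ← sum_sub_distrib, ← sum_sub_distrib]
    refine sum_le_sum fun p _ => ?_
    have h1 : |d φ p - 1| ≤ (d φ p - 1) ^ 2 / (4 * θ) + θ := by
      rw [← sq_abs]
      have : 0 ≤ (|d φ p - 1| - 2 * θ) ^ 2 / (4 * θ) := by positivity
      have h2 : (|d φ p - 1| - 2 * θ) ^ 2 / (4 * θ) =
          |d φ p - 1| ^ 2 / (4 * θ) + θ - |d φ p - 1| := by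
        field_simp
        ring
      linarith
    have h3 : max (d φ p - 1) 0 ≤ |d φ p - 1| := max_le (le_abs_self _) (abs_nonneg _)
    have h4 : 1 / (k : ℝ) - d φ p / k ≤ |d φ p - 1| := by
      rw [← sub_div, div_le_iff₀ hkR]
      have := neg_abs_le (d φ p - 1)
      nlinarith [abs_nonneg (d φ p - 1)]
    change 1 / (k : ℝ) - 2 * ((d φ p - 1) ^ 2 / (4 * θ) + θ) ≤ d φ p / k - max (d φ p - 1) 0
    linarith
  have hWpos : 0 ≤ W := by positivity
  have hsum := sum_le_sum fun φ (_ : φ ∈ univ) => hbound φ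
  refine le_trans ?_ hsum
  rw [sum_sub_distrib, sum_comm]
  have hcardW : ∑ φ : ι → X, T = T * W := by
    simp [hW, mul_comm]
  have h5 : ∀ p, ∑ φ, 2 * ((d φ p - 1) ^ 2 / (4 * θ) + θ) ≤
      2 * (C * k ^ k / D / (4 * θ) + θ) * W := by
    intro p
    rw [← mul_sum, sum_add_distrib, ← sum_div]
    have : ∑ φ : ι → X, θ = θ * W := by simp [hW, mul_comm]
    rw [this]
    have h6 := div_le_div_of_nonneg_right (hvar p) (by positivity : 0 ≤ 4 * θ)
    calc _ ≤ 2 * (C * k ^ k / D * W / (4 * θ) + θ * W) := by linarith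
      _ = _ := by ring
  have h7 := sum_le_sum fun p (_ : p ∈ (univ : Finset (ι × Fin k))) => h5 p
  have h8 : C * k ^ k / D / (4 * θ) ≤ ε / (4 * k) := by
    rw [hθ, div_div, div_le_div_iff₀ (by positivity) (by positivity)]
    field_simp
    nlinarith
  have h9 : ∑ p : ι × Fin k, 2 * (C * k ^ k / D / (4 * θ) + θ) * W ≤ ε * T * W := by
    simp only [sum_const, card_univ, Fintype.card_prod, Fintype.card_fin, nsmul_eq_mul]
    push_cast
    calc (T * k) * (2 * (C * k ^ k / D / (4 * θ) + θ) * W)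
        ≤ (T * k) * (2 * (ε / (4 * k) + ε / (4 * k)) * W) := by gcongr
      _ = ε * T * W := by
        field_simp
        ring
  rw [hcardW]
  linarith

/-- Over a large vertex set partitioned into `k`-element cells, a matching of cells that misses a
positive proportion of the vertices is not maximum, provided there is a spread perfect fractional
matching. -/
theorem exists_larger_matching (k : ℕ) (hk : 0 < k) (C η : ℝ) (hη : 0 < η) :
    ∃ N₀ : ℕ, ∀ (X : Type) [Fintype X] [DecidableEq X], N₀ ≤ Fintype.card X →
      ∀ (H : Finset (Finset (X × Fin k))) (g : (Fin k → X × Fin k) → ℝ), (∀ v, 0 ≤ g v) →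
        (∀ v, g v ≤ C) → (∀ v, g v ≠ 0 → univ.image v ∈ H) →
        (∀ i x, ∑ v with v i = x, g v = (Fintype.card X : ℝ) ^ (k - 1)) →
        ∀ I : Finset X, (∀ c ∈ I, univ.image (fun s : Fin k => (c, s)) ∈ H) →
          (I.card : ℝ) ≤ (1 - η) * Fintype.card X →
          ∃ M ⊆ H, (M : Set (Finset (X × Fin k))).PairwiseDisjoint id ∧ I.card < M.card := by
  classical
  obtain ⟨D₀, hD₀⟩ := exists_nat_gt (4 * (k : ℝ) ^ 2 * (C * k ^ k) / (η / 2) ^ 2)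
  obtain ⟨ι, L, _, _, _, _, D, ρ, pos, hι, hDD, hD, hpos, hreg, hlin⟩ :=
    exists_linear_pattern k D₀ hk
  have hDε : 4 * (k : ℝ) ^ 2 * (C * k ^ k) ≤ (η / 2) ^ 2 * D := by
    rw [div_lt_iff₀ (by positivity)] at hD₀
    have : (D₀ : ℝ) ≤ D := by exact_mod_cast hDD
    nlinarith [sq_nonneg (η / 2)]
  set T : ℝ := (Fintype.card ι : ℝ) with hT
  have hTpos : 0 < T := by
    rw [hT]
    exact_mod_cast Fintype.card_pos
  have hkR : (0 : ℝ) < k := by exact_mod_cast hk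
  obtain ⟨b, hb⟩ := exists_nat_gt ((Fintype.card (L × (Fin k → Fin k)) : ℝ) * 4 / (η * T))
  have hbR : (0 : ℝ) < b := lt_of_le_of_lt (by positivity) hb
  have hbpos : 0 < b := by exact_mod_cast hbR
  rw [div_lt_iff₀ (by positivity)] at hb
  let Ty := Finset ι × Finset (L × (Fin k → Fin k))
  have hKpos : (0 : ℝ) < Fintype.card Ty := by exact_mod_cast Fintype.card_pos
  obtain ⟨N₀, hN₀⟩ := exists_injective_blowup ι b (η / 4 / Fintype.card Ty) (by positivity)
  refine ⟨N₀ + 1, fun X _ _ hX H g g0 gC gH gm I hIH hI => ?_⟩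
  set W : ℝ := (Fintype.card X : ℝ) ^ Fintype.card ι with hW
  have hXpos : (0 : ℝ) < Fintype.card X := by exact_mod_cast (by omega : 0 < Fintype.card X)
  have hWpos : 0 < W := by positivity
  obtain ⟨y, y0, yg, y1, ysum⟩ := exists_sampled_fractional_matching hk hD ρ pos hpos hreg hlin C
    (η / 2) (by positivity) hDε g g0 gC gm
  let A : (ι → X) → Finset ι := fun φ => univ.filter fun j => φ j ∈ I
  let J : (ι → X) → Finset (L × (Fin k → Fin k)) := fun φ =>
    univ.filter fun e => univ.image (fun l => (φ (ρ e.1 l), e.2 l)) ∈ H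
  let Y : (ι → X) → ℝ := fun φ => ∑ e, y φ e - (A φ).card
  have hYT : ∀ φ, Y φ ≤ T := by
    intro φ
    have h1 := sum_le_sum fun p (_ : p ∈ (univ : Finset (ι × Fin k))) => y1 φ p
    simp only [sum_filter] at h1
    rw [sum_comm] at h1
    have h2 : ∀ e : L × (Fin k → Fin k), ∑ p : ι × Fin k,
        (if p ∈ univ.image (fun l => (ρ e.1 l, e.2 l)) then y φ e else 0) = y φ e * k := by
      intro e
      rw [← sum_filter, sum_const, filter_mem_eq_inter, univ_inter, card_image_of_injective]
      · simp [mul_comm]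
      · intro l l' h
        have := congrArg (fun q => pos q.1) h
        simpa [hpos] using this
    simp_rw [h2] at h1
    rw [← sum_mul] at h1
    simp only [sum_const, card_univ, Fintype.card_prod, Fintype.card_fin, nsmul_eq_mul,
      mul_one, Nat.cast_mul] at h1
    have h3 := le_of_mul_le_mul_right h1 hkR
    have : (0 : ℝ) ≤ (A φ).card := by positivity
    simp only [Y]
    linarith
  have hAsum : ∑ φ, ((A φ).card : ℝ) ≤ (1 - η) * T * W := by
    have h1 : ∑ φ, (A φ).card =
        Fintype.card ι * (I.card * Fintype.card X ^ (Fintype.card ι - 1)) := by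
      simp only [A, card_filter]
      rw [sum_comm]
      simp_rw [← card_filter, card_filter_apply_mem]
      simp
    have h2 : ∑ φ, ((A φ).card : ℝ) =
        T * (I.card * (Fintype.card X : ℝ) ^ (Fintype.card ι - 1)) := by
      rw [hT]
      exact_mod_cast h1
    have h3 : W = Fintype.card X * (Fintype.card X : ℝ) ^ (Fintype.card ι - 1) := by
      rw [hW, ← pow_succ', Nat.sub_add_cancel Fintype.card_pos]
    rw [h2, h3]
    calc _ ≤ T * ((1 - η) * Fintype.card X * (Fintype.card X : ℝ) ^ (Fintype.card ι - 1)) := by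
          gcongr
      _ = _ := by ring
  have hYsum : η / 2 * T * W ≤ ∑ φ, Y φ := by
    simp only [Y]
    rw [sum_sub_distrib]
    linarith
  let S : Finset (ι → X) := univ.filter fun φ => η * T / 4 ≤ Y φ
  have hS : η / 4 * W ≤ S.card := by
    have h1 : ∀ φ, Y φ ≤ (if φ ∈ S then T else 0) + η * T / 4 := by
      intro φ
      by_cases h : η * T / 4 ≤ Y φ
      · have := hYT φ
        simp only [S, mem_filter, mem_univ, true_and, h, if_true]
        have : 0 < η * T / 4 := by positivity
        linarith
      · simp only [S, mem_filter, mem_univ, true_and, h, if_false]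
        linarith
    have h2 := hYsum.trans (sum_le_sum fun φ (_ : φ ∈ univ) => h1 φ)
    rw [sum_add_distrib] at h2
    simp only [sum_ite_mem, univ_inter, sum_const, nsmul_eq_mul, card_univ, Fintype.card_fun,
      Nat.cast_pow] at h2
    rw [← hW] at h2
    have : T * (η / 4 * W) ≤ T * S.card := by linarith
    exact le_of_mul_le_mul_left this hTpos
  obtain ⟨τ, -, hτ⟩ := exists_le_card_fiber_of_nsmul_le_card_of_maps_to
    (s := S) (t := (univ : Finset Ty)) (f := fun φ => ((A φ, J φ) : Ty))
    (b := η / 4 / Fintype.card Ty * W) (fun _ _ => mem_univ _) univ_nonempty (by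
      rw [nsmul_eq_mul, card_univ]
      refine le_trans (le_of_eq ?_) hS
      field_simp)
  obtain ⟨B, hB, hBG⟩ := hN₀ X (by omega)
    {φ | φ ∈ S.filter fun φ => ((A φ, J φ) : Ty) = τ} (by
      refine hτ.trans (le_of_eq ?_)
      rw [Nat.card_eq_fintype_card, Fintype.card_subtype]
      congr 2
      ext
      simp)
  obtain ⟨A₀, J₀⟩ := τ
  have hG : ∀ c : ι → Fin b, (fun j => B j (c j)) ∈ S ∧ A (fun j => B j (c j)) = A₀ ∧
      J (fun j => B j (c j)) = J₀ := by
    intro c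
    have := hBG c
    simpa only [Set.mem_ofPred_eq, mem_filter, Prod.mk.injEq] using this
  set φ₀ : ι → X := fun j => B j ⟨0, hbpos⟩ with hφ₀
  obtain ⟨hφS, hφA, hφJ⟩ := hG fun _ => ⟨0, hbpos⟩
  obtain ⟨M', hM'H, hM'd, hM'c, hM'B⟩ := exists_matching_of_blowup hk hbpos H B hB
    (fun (e : L × (Fin k → Fin k)) l => ρ e.1 l) (fun e => e.2) (fun e => ⌊b * y φ₀ e⌋₊)
    (by
      intro e he a
      have hy : y φ₀ e ≠ 0 := by
        intro h
        simp [h] at he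
      have he' : e ∈ J φ₀ := by
        simp only [J, mem_filter, mem_univ, true_and]
        exact gH _ fun h => hy (yg _ _ h)
      rw [hφJ, ← (hG fun j => a (pos j)).2.2] at he'
      simpa [J, hpos] using he')
    (by
      intro p
      have h1 : ((∑ e with p ∈ univ.image (fun l => (ρ e.1 l, e.2 l)), ⌊b * y φ₀ e⌋₊ : ℕ) : ℝ) ≤
          b := by
        push_cast
        calc _ ≤ ∑ e with p ∈ univ.image (fun l => (ρ e.1 l, e.2 l)), b * y φ₀ e :=
              sum_le_sum fun e _ => Nat.floor_le (mul_nonneg hbR.le (y0 _ _))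
          _ = b * ∑ e with p ∈ univ.image (fun l => (ρ e.1 l, e.2 l)), y φ₀ e := by
              rw [mul_sum]
          _ ≤ b * 1 := by gcongr; exact y1 φ₀ p
          _ = b := mul_one _
      exact_mod_cast h1)
  have hsize : (b : ℝ) * A₀.card < M'.card := by
    rw [hM'c]
    push_cast
    have h1 : ∑ e : L × (Fin k → Fin k), (b * y φ₀ e - 1) ≤ ∑ e, (⌊b * y φ₀ e⌋₊ : ℝ) :=
      sum_le_sum fun e _ => (Nat.sub_one_lt_floor _).le
    rw [sum_sub_distrib, ← mul_sum] at h1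
    simp only [sum_const, card_univ, nsmul_eq_mul, mul_one] at h1
    have h2 : η * T / 4 ≤ Y φ₀ := by simpa [S] using hφS
    have hφA' : A φ₀ = A₀ := hφA
    simp only [Y, hφA'] at h2
    have h3 := mul_le_mul_of_nonneg_left h2 hbR.le
    nlinarith
  let cell : X → Finset (X × Fin k) := fun c => univ.image (fun s : Fin k => (c, s))
  have hcell : ∀ c x, x ∈ cell c ↔ x.1 = c := by
    intro c x
    simp only [cell, mem_image, mem_univ, true_and]
    constructor
    · rintro ⟨s, rfl⟩
      rfl
    · rintro rfl
      exact ⟨x.2, rfl⟩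
  have hcellinj : Function.Injective cell := by
    intro c c' h
    have : (c, (⟨0, hk⟩ : Fin k)) ∈ cell c' := by
      rw [← h, hcell]
    exact (hcell _ _).mp this
  let U : Finset X := (A₀ ×ˢ (univ : Finset (Fin b))).image fun q => B q.1 q.2
  have hU : U.card ≤ A₀.card * b := card_image_le.trans (by simp)
  have hdisj : ∀ f ∈ M', ∀ c ∈ I \ U, Disjoint f (cell c) := by
    intro f hf c hc
    refine disjoint_left.mpr fun x hxf hxc => ?_
    obtain ⟨hcI, hcU⟩ := mem_sdiff.mp hc
    obtain ⟨j, a, hja⟩ := hM'B f hf x hxf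
    rw [hcell] at hxc
    apply hcU
    have : j ∈ A₀ := by
      rw [← (hG fun _ => a).2.1]
      simp only [A, mem_filter, mem_univ, true_and]
      rwa [← hja, hxc]
    exact mem_image.mpr ⟨(j, a), by simp [this], by rw [← hxc, hja]⟩
  have hne : ∀ c, (cell c).Nonempty := fun c => ⟨(c, ⟨0, hk⟩), by rw [hcell]⟩
  refine ⟨M' ∪ (I \ U).image cell, ?_, ?_, ?_⟩
  · refine union_subset hM'H fun f hf => ?_
    obtain ⟨c, hc, rfl⟩ := mem_image.mp hf
    exact hIH c (mem_sdiff.mp hc).1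
  · rw [coe_union, Set.pairwiseDisjoint_union]
    refine ⟨hM'd, ?_, ?_⟩
    · intro f hf f' hf' hne'
      obtain ⟨c, -, rfl⟩ := mem_image.mp (mem_coe.mp hf)
      obtain ⟨c', -, rfl⟩ := mem_image.mp (mem_coe.mp hf')
      refine disjoint_left.mpr fun x hx hx' => hne' ?_
      simp only [id, hcell] at hx hx'
      rw [← hx, hx']
    · intro f hf f' hf' _
      obtain ⟨c', hc', rfl⟩ := mem_image.mp (mem_coe.mp hf')
      exact hdisj f hf c' hc'
  · rw [card_union_of_disjoint, card_image_of_injective _ hcellinj]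
    · have h1 : I.card ≤ (I \ U).card + U.card := by
        have := le_card_sdiff U I
        omega
      have h2 : b * A₀.card < M'.card := by exact_mod_cast hsize
      have h3 : A₀.card * b = b * A₀.card := mul_comm _ _
      omega
    · refine disjoint_left.mpr fun f hf hf' => ?_
      obtain ⟨c, hc, rfl⟩ := mem_image.mp hf'
      have := hdisj _ hf c hc
      rw [disjoint_self] at this
      exact (hne c).ne_empty this

/-- Either a hypergraph has a perfect fractional matching with all weights at most `c`, or linear
programming duality provides an obstruction. -/
theorem exists_bounded_perfect_weight_or_dual {X : Type*} [Fintype X] [DecidableEq X]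
    (H : Finset (Finset X)) {c : ℝ} (hc : 0 ≤ c) :
    (∃ w : Finset X → ℝ, (∀ e, 0 ≤ w e) ∧ (∀ e, w e ≤ c) ∧ (∀ e, w e ≠ 0 → e ∈ H) ∧
      ∀ x, ∑ e with x ∈ e, w e = 1) ∨
    ∃ u : X → ℝ, c * ∑ e ∈ H, max (-∑ x ∈ e, u x) 0 < -∑ x, u x := by
  classical
  let A : (Finset X → ℝ) →ₗ[ℝ] (X → ℝ) :=
    LinearMap.pi fun x => ∑ e with x ∈ e, LinearMap.proj e
  have hA : ∀ w x, A w x = ∑ e with x ∈ e, w e := fun w x => by simp [A]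
  let B : Set (Finset X → ℝ) := Set.Icc 0 fun e => if e ∈ H then c else 0
  by_cases h : (1 : X → ℝ) ∈ A '' B
  · obtain ⟨w, ⟨hw0, hw1⟩, hw⟩ := h
    refine Or.inl ⟨w, hw0, fun e => (hw1 e).trans ?_, fun e he => ?_, fun x => ?_⟩
    · dsimp only
      split_ifs <;> simp [hc]
    · by_contra h
      refine he (le_antisymm ?_ (hw0 e))
      simpa [h] using hw1 e
    · rw [← hA, hw, Pi.one_apply]
  · right
    have hK : IsCompact (A '' B) := isCompact_Icc.image A.continuous_of_finiteDimensional
    obtain ⟨f, t, hf1, hft⟩ := geometric_hahn_banach_point_closed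
      ((convex_Icc _ _).linear_image A) hK.isClosed h
    let u : X → ℝ := fun x => f (Pi.single x 1)
    have hf : ∀ z, f z = ∑ x, z x * u x := by
      intro z
      conv_lhs => rw [pi_eq_sum_univ' z]
      rw [map_sum]
      refine sum_congr rfl fun x _ => ?_
      rw [map_smul, smul_eq_mul]
    refine ⟨u, ?_⟩
    let w : Finset X → ℝ := fun e => if e ∈ H ∧ ∑ x ∈ e, u x < 0 then c else 0
    have hw : w ∈ B := by
      constructor
      · intro e
        simp only [w, Pi.zero_apply]
        split_ifs <;> simp [hc]
      · intro e
        simp only [w]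
        split_ifs <;> simp_all
    have h1 := hft _ (Set.mem_image_of_mem A hw)
    have h2 : f (A w) = -(c * ∑ e ∈ H, max (-∑ x ∈ e, u x) 0) := by
      rw [hf]
      simp_rw [hA, sum_filter, sum_mul]
      rw [sum_comm, mul_sum, ← sum_neg_distrib, ← univ_inter H, ← sum_ite_mem]
      refine sum_congr rfl fun e _ => ?_
      simp_rw [ite_mul, zero_mul]
      rw [← sum_filter, filter_mem_eq_inter, univ_inter, ← mul_sum]
      simp only [w]
      by_cases he : e ∈ H
      · by_cases hu : ∑ x ∈ e, u x < 0
        · rw [if_pos ⟨he, hu⟩, if_pos he, max_eq_left (by linarith)]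
          ring
        · rw [if_neg (by tauto), if_pos he, max_eq_right (by linarith)]
          ring
      · rw [if_neg (by tauto), if_neg he, zero_mul]
    rw [h2] at h1
    rw [hf] at hf1
    simp only [Pi.one_apply, one_mul] at hf1
    linarith

theorem exists_threshold {X : Type*} [Fintype X] [Nonempty X] (u : X → ℝ) {m : ℕ}
    (hm : m ≤ Fintype.card X) (hm0 : 0 < m) :
    ∃ a, m ≤ (univ.filter fun x => u x ≤ a).card ∧ (univ.filter fun x => u x < a).card < m := by
  classical
  let T : Finset ℝ := (univ.image u).filter fun a => m ≤ (univ.filter fun x => u x ≤ a).card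
  have hT : T.Nonempty := by
    obtain ⟨x₀, -, hx₀⟩ := exists_max_image univ u univ_nonempty
    refine ⟨u x₀, mem_filter.mpr ⟨mem_image_of_mem _ (mem_univ _), ?_⟩⟩
    rwa [filter_true_of_mem fun x hx => hx₀ x hx, card_univ]
  refine ⟨T.min' hT, (mem_filter.mp (T.min'_mem hT)).2, ?_⟩
  by_contra! h
  have hne : (univ.filter fun x => u x < T.min' hT).Nonempty := card_pos.mp (by omega)
  obtain ⟨x₀, hx₀, hmax⟩ := exists_max_image _ u hne
  have hmem : u x₀ ∈ T := by
    refine mem_filter.mpr ⟨mem_image_of_mem _ (mem_univ _), h.trans (card_le_card fun x hx => ?_)⟩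
    exact mem_filter.mpr ⟨mem_univ _, hmax x hx⟩
  exact absurd (T.min'_le _ hmem) (not_le.mpr (mem_filter.mp hx₀).2)

theorem card_filter_mem_le_pow {X : Type*} [Fintype X] [DecidableEq X] {k : ℕ}
    {H : Finset (Finset X)} (hH : ∀ e ∈ H, e.card = k) (x : X) :
    (H.filter fun e => x ∈ e).card ≤ Fintype.card X ^ (k - 1) := by
  calc _ ≤ (powersetCard (k - 1) (univ : Finset X)).card := by
        refine card_le_card_of_injOn (fun e => e.erase x) ?_ ?_
        · intro e he
          obtain ⟨he, hx⟩ := mem_filter.mp (mem_coe.mp he)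
          exact mem_coe.mpr (mem_powersetCard.mpr
            ⟨subset_univ _, by rw [card_erase_of_mem hx, hH e he]⟩)
        · intro e he f hf hef
          have he := (mem_filter.mp (mem_coe.mp he)).2
          have hf := (mem_filter.mp (mem_coe.mp hf)).2
          rw [← insert_erase he, ← insert_erase hf]
          exact congrArg _ hef
    _ ≤ _ := by
        rw [card_powersetCard, card_univ]
        exact Nat.choose_le_pow _ _

/-- Greedily extending a vertex inside `W` produces many edges through it. -/
theorem pow_le_card_filter_erase_subset {X : Type*} [DecidableEq X] [Fintype X] {k m : ℕ}
    (hk : 0 < k) {H : Finset (Finset X)} (hH : ∀ e ∈ H, e.card = k) (W : Finset X)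
    (hm : ∀ T : Finset X, T.card = k - 1 → (∃ e ∈ H, T ⊆ e) →
      m ≤ (W.filter fun x => x ∉ T ∧ insert x T ∈ H).card)
    (x : X) (hx : ∃ e ∈ H, x ∈ e) :
    m ^ (k - 1) ≤ k ^ (k - 1) * (H.filter fun e => x ∈ e ∧ e.erase x ⊆ W).card := by
  classical
  let P : ℕ → Finset (Finset X) := fun j => (powersetCard j W).filter fun S =>
    x ∉ S ∧ ∃ e ∈ H, insert x S ⊆ e
  have hP : ∀ {j S}, S ∈ P j ↔ (S ⊆ W ∧ S.card = j) ∧ x ∉ S ∧ ∃ e ∈ H, insert x S ⊆ e := by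
    intro j S
    simp only [P, mem_filter, mem_powersetCard]
  have key : ∀ j ≤ k - 1, m ^ j ≤ k ^ j * (P j).card := by
    intro j
    induction j with
    | zero =>
      intro _
      have : ∅ ∈ P 0 := hP.mpr ⟨by simp, by simp, by simpa using hx⟩
      have := card_pos.mpr ⟨_, this⟩
      simpa
    | succ j ih =>
      intro hj
      have hstep : (P j).card * m ≤ (P (j + 1)).card * k := by
        refine card_mul_le_card_mul (fun S S' => S ⊆ S') ?_ ?_
        · intro S hS
          obtain ⟨⟨hSW, hSc⟩, hxS, e, he, hSe⟩ := hP.mp hS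
          obtain ⟨T, hST, hTe, hTc⟩ := exists_subsuperset_card_eq (n := k - 1) hSe
            (by rw [card_insert_of_notMem hxS]; omega) (by rw [hH e he]; omega)
          refine (hm T hTc ⟨e, he, hTe⟩).trans
            (card_le_card_of_injOn (fun z => insert z S) ?_ ?_)
          · intro z hz
            obtain ⟨hzW, hzT, hzH⟩ := mem_filter.mp (mem_coe.mp hz)
            have hzS : z ∉ insert x S := fun h => hzT (hST h)
            rw [mem_insert, not_or] at hzS
            refine mem_coe.mpr (mem_filter.mpr ⟨hP.mpr ⟨⟨insert_subset hzW hSW, ?_⟩, ?_, ?_⟩,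
              subset_insert _ _⟩)
            · rw [card_insert_of_notMem hzS.2, hSc]
            · rw [mem_insert, not_or]
              exact ⟨fun h => hzS.1 h.symm, hxS⟩
            · exact ⟨_, hzH, by rw [insert_comm]; exact insert_subset_insert _ hST⟩
          · intro z hz z' hz' h
            have hzS : ∀ z, z ∈ W.filter (fun x => x ∉ T ∧ insert x T ∈ H) → z ∉ S :=
              fun z hz h => (mem_filter.mp hz).2.1 (hST (mem_insert_of_mem h))
            have : z ∈ insert z' S := by
              rw [← show insert z S = insert z' S from h]
              exact mem_insert_self _ _
            exact (mem_insert.mp this).resolve_right (hzS z (mem_coe.mp hz))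
        · intro S' hS'
          obtain ⟨⟨-, hSc⟩, -⟩ := hP.mp hS'
          calc _ ≤ (powersetCard j S').card := by
                refine card_le_card fun S hS => ?_
                obtain ⟨hS, hSS'⟩ := mem_filter.mp hS
                exact mem_powersetCard.mpr ⟨hSS', (hP.mp hS).1.2⟩
            _ = j + 1 := by
                rw [card_powersetCard, hSc, Nat.choose_succ_self_right]
            _ ≤ k := by omega
      calc m ^ (j + 1) = m ^ j * m := pow_succ _ _
        _ ≤ k ^ j * (P j).card * m := by gcongr; exact ih (by omega)
        _ = k ^ j * ((P j).card * m) := by ring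
        _ ≤ k ^ j * ((P (j + 1)).card * k) := by gcongr
        _ = _ := by ring
  refine (key (k - 1) le_rfl).trans (Nat.mul_le_mul_left _ ?_)
  refine card_le_card_of_injOn (fun S => insert x S) ?_ ?_
  · intro S hS
    obtain ⟨⟨hSW, hSc⟩, hxS, e, he, hSe⟩ := hP.mp (mem_coe.mp hS)
    have hcard : (insert x S).card = e.card := by
      rw [card_insert_of_notMem hxS, hSc, hH e he]
      omega
    have := eq_of_subset_of_card_le hSe hcard.ge
    refine mem_coe.mpr (mem_filter.mpr ⟨?_, mem_insert_self _ _, ?_⟩)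
    · dsimp only
      rwa [this]
    · dsimp only
      rwa [erase_insert hxS]
  · intro S hS S' hS' h
    have hxS := (hP.mp (mem_coe.mp hS)).2.1
    have hxS' := (hP.mp (mem_coe.mp hS')).2.1
    rw [← erase_insert hxS, ← erase_insert hxS']
    exact congrArg (fun f => f.erase x) h

theorem minPosCodeg_le_card_extensions (k : ℕ) (H : Finset (Finset V)) (T : Finset V)
    (hH : ∀ e ∈ H, e.card = k) (hk : 0 < k) (hT : T.card = k - 1) (hTH : ∃ e ∈ H, T ⊆ e) :
    minPosCodeg k H ≤ (univ.filter fun x => x ∉ T ∧ insert x T ∈ H).card := by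
  obtain ⟨e₀, he₀, hTe₀⟩ := hTH
  have h1 : minPosCodeg k H ≤ deg H T :=
    Nat.sInf_le ⟨T, hT, card_pos.mpr ⟨e₀, mem_filter.mpr ⟨he₀, hTe₀⟩⟩, rfl⟩
  refine h1.trans (le_trans (card_le_card ?_) (card_image_le (f := fun x => insert x T)))
  intro e he
  obtain ⟨he, hTe⟩ := mem_filter.mp he
  obtain ⟨x, hx⟩ := card_eq_one.mp (show (e \ T).card = 1 by
    rw [card_sdiff_of_subset hTe, hH e he, hT]
    omega)
  have hxe : insert x T = e := by
    rw [insert_eq, ← hx, sdiff_union_of_subset hTe]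
  have hxT : x ∉ T := (mem_sdiff.mp (hx ▸ mem_singleton_self x)).2
  exact mem_image.mpr ⟨x, mem_filter.mpr ⟨mem_univ _, hxT, by rwa [hxe]⟩, hxe⟩

/-- If every vertex lies in many edges whose other vertices have potential at most `a`, then few
vertices have potential much below `-(k-1)a`, in a weighted sense. -/
theorem sum_neg_part_le {X : Type*} [Fintype X] [DecidableEq X] {k : ℕ} (hk : 0 < k)
    {H : Finset (Finset X)} (hH : ∀ e ∈ H, e.card = k) (u : X → ℝ) (a p q : ℝ) (hq : 0 ≤ q)
    (hp : ∀ x, p ≤ q *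
      (H.filter fun e => x ∈ e ∧ e.erase x ⊆ univ.filter fun z => u z ≤ a).card) :
    p * ∑ x, max (-(u x + (k - 1) * a)) 0 ≤ q * (k * ∑ e ∈ H, max (-∑ x ∈ e, u x) 0) := by
  have h1 : ∀ x, p * max (-(u x + (k - 1) * a)) 0 ≤
      q * ∑ e ∈ H with x ∈ e, max (-∑ z ∈ e, u z) 0 := by
    intro x
    calc p * max (-(u x + (k - 1) * a)) 0 ≤ q * (H.filter fun e => x ∈ e ∧
          e.erase x ⊆ univ.filter fun z => u z ≤ a).card * max (-(u x + (k - 1) * a)) 0 :=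
          mul_le_mul_of_nonneg_right (hp x) (le_max_right _ _)
      _ = q * ∑ e ∈ H with x ∈ e ∧ e.erase x ⊆ univ.filter (fun z => u z ≤ a),
          max (-(u x + (k - 1) * a)) 0 := by
          rw [sum_const, nsmul_eq_mul, mul_assoc]
      _ ≤ q * ∑ e ∈ H with x ∈ e ∧ e.erase x ⊆ univ.filter (fun z => u z ≤ a),
          max (-∑ z ∈ e, u z) 0 := by
          gcongr with e he
          obtain ⟨he, hxe, hea⟩ := mem_filter.mp he
          have h2 : ∑ z ∈ e.erase x, u z ≤ (e.erase x).card • a :=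
            sum_le_card_nsmul _ _ _ fun z hz => (mem_filter.mp (hea hz)).2
          rw [card_erase_of_mem hxe, hH e he, nsmul_eq_mul, Nat.cast_pred hk] at h2
          rw [← add_sum_erase _ _ hxe]
          linarith
      _ ≤ q * ∑ e ∈ H with x ∈ e, max (-∑ z ∈ e, u z) 0 := by
          gcongr q * ?_
          refine sum_le_sum_of_subset_of_nonneg ?_ fun _ _ _ => le_max_right _ _
          exact monotone_filter_right _ fun e _ h => h.1
  rw [mul_sum]
  refine (sum_le_sum fun x _ => h1 x).trans (le_of_eq ?_)
  rw [← mul_sum]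
  congr 1
  simp_rw [sum_filter]
  rw [sum_comm, mul_sum]
  refine sum_congr rfl fun e he => ?_
  rw [← sum_filter, sum_const, filter_mem_eq_inter, univ_inter, hH e he, nsmul_eq_mul]

/-- Few edges meet a small set, so if many edges have two vertices in `S`, many of them avoid any
given small set. -/
theorem card_filter_disjoint_ge {X : Type*} [Fintype X] [DecidableEq X] {k : ℕ}
    {H : Finset (Finset X)} (hH : ∀ e ∈ H, e.card = k) (S B : Finset X) :
    (H.filter fun e => 2 ≤ (e ∩ S).card).card ≤
      (H.filter fun e => 2 ≤ (e ∩ S).card ∧ Disjoint e B).card +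
        B.card * Fintype.card X ^ (k - 1) := by
  have h1 : (H.filter fun e => ¬Disjoint e B).card ≤ B.card * Fintype.card X ^ (k - 1) := by
    refine (card_le_card (t := B.biUnion fun x => H.filter fun e => x ∈ e) ?_).trans
      (card_biUnion_le_card_mul _ _ _ fun x _ => card_filter_mem_le_pow hH x)
    intro e he
    obtain ⟨he, hB⟩ := mem_filter.mp he
    obtain ⟨x, hxe, hxB⟩ := not_disjoint_iff.mp hB
    exact mem_biUnion.mpr ⟨x, hxB, mem_filter.mpr ⟨he, hxe⟩⟩
  refine (card_le_card ?_).trans ((card_union_le _ _).trans (Nat.add_le_add_left h1 _))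
  intro e he
  obtain ⟨he, h2⟩ := mem_filter.mp he
  rw [mem_union, mem_filter, mem_filter]
  by_cases h : Disjoint e B
  · exact Or.inl ⟨he, h2, h⟩
  · exact Or.inr ⟨he, h⟩

set_option maxHeartbeats 1000000 in
/-- A dual obstruction to a spread perfect fractional matching forces extremality. -/
theorem isExtremal_of_dual {k : ℕ} (hk : 2 ≤ k) {γ α : ℝ} (hα : 0 < α) (hα6 : α ≤ 1 / 6)
    (hαγ : 12 * k * α ≤ γ) {H : Finset (Finset V)} (hH : ∀ e ∈ H, e.card = k)
    (hn : 1 ≤ α * Fintype.card V) (hkn : k ∣ Fintype.card V)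
    (hcodeg : ((k : ℝ) - 1) / k * Fintype.card V - α * Fintype.card V ≤ (minPosCodeg k H : ℝ))
    (hcover : ∀ x, ∃ e ∈ H, x ∈ e) (u : V → ℝ)
    (hu : 2 * k ^ k / α ^ (k - 1) / (Fintype.card V : ℝ) ^ (k - 1) *
      ∑ e ∈ H, max (-∑ x ∈ e, u x) 0 < -∑ x, u x) : IsExtremal k γ H := by
  obtain ⟨N, hN⟩ := hkn
  set n : ℝ := (Fintype.card V : ℝ) with hnV
  have hnN : n = k * N := by
    rw [hnV, hN]
    push_cast
    rfl
  have hkR : (2 : ℝ) ≤ k := by exact_mod_cast hk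
  have hk0 : 0 < k := by omega
  have hn0 : 0 < n := by
    by_contra h
    nlinarith
  have hα1 : α ^ (k - 1) ≤ 1 := pow_le_one₀ hα.le (by linarith)
  have hαp : 0 < α ^ (k - 1) := by positivity
  set m : ℕ := ⌈(N : ℝ) + 2 * α * n⌉₊ with hm
  have hm1 : (N : ℝ) + 2 * α * n ≤ m := Nat.le_ceil _
  have hm2 : (m : ℝ) < N + 2 * α * n + 1 := Nat.ceil_lt_add_one (by positivity)
  have hN0 : (0 : ℝ) ≤ N := by positivity
  have hmn : m ≤ Fintype.card V := by
    have : (m : ℝ) ≤ n := by nlinarith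
    rw [hnV] at this
    exact_mod_cast this
  have hm0 : 0 < m := by
    have : (0 : ℝ) < m := by nlinarith
    exact_mod_cast this
  have : Nonempty V := Fintype.card_pos_iff.mp (by omega)
  obtain ⟨a, ha1, ha2⟩ := exists_threshold u hmn hm0
  set Neg := ∑ e ∈ H, max (-∑ x ∈ e, u x) 0 with hNeg
  have hNeg0 : 0 ≤ Neg := sum_nonneg fun _ _ => le_max_right _ _
  have hext : ∀ T : Finset V, T.card = k - 1 → (∃ e ∈ H, T ⊆ e) →
      ⌈α * n⌉₊ ≤ ((univ.filter fun z => u z ≤ a).filter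
        fun x => x ∉ T ∧ insert x T ∈ H).card := by
    intro T hT hTH
    have h1 := minPosCodeg_le_card_extensions k H T hH hk0 hT hTH
    have h2 := card_union_add_card_inter (univ.filter fun z => u z ≤ a)
      (univ.filter fun x => x ∉ T ∧ insert x T ∈ H)
    have h3 := card_le_univ ((univ.filter fun z => u z ≤ a) ∪
      (univ.filter fun x => x ∉ T ∧ insert x T ∈ H))
    rw [inter_filter, inter_univ] at h2
    have h4 : (minPosCodeg k H : ℝ) + m ≤ n + (((univ.filter fun z => u z ≤ a).filter
        fun x => x ∉ T ∧ insert x T ∈ H).card : ℝ) := by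
      rw [hnV]
      exact_mod_cast (by omega)
    have h5 : ((k : ℝ) - 1) / k * n = n - N := by
      rw [hnN]
      field_simp
    refine Nat.ceil_le.mpr ?_
    linarith
  have hdeg : ∀ x, (α * n) ^ (k - 1) ≤ (k : ℝ) ^ (k - 1) *
      (H.filter fun e => x ∈ e ∧ e.erase x ⊆ univ.filter fun z => u z ≤ a).card := by
    intro x
    have h1 := pow_le_card_filter_erase_subset hk0 hH _ hext x (hcover x)
    calc (α * n) ^ (k - 1) ≤ (⌈α * n⌉₊ : ℝ) ^ (k - 1) := by gcongr; exact Nat.le_ceil _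
      _ ≤ _ := by exact_mod_cast h1
  have hsum := sum_neg_part_le hk0 hH u a _ _ (by positivity) hdeg
  rw [← hNeg] at hsum
  set D := -∑ x, u x with hD
  let r : V → ℝ := fun x => max (-(u x + (k - 1) * a)) 0
  have hr0 : ∀ x, 0 ≤ r x := fun x => le_max_right _ _
  have hnp : 0 < n ^ (k - 1) := by positivity
  have hD0 : 0 < D := lt_of_le_of_lt (by positivity) hu
  have hkk : (k : ℝ) ^ k = k * k ^ (k - 1) := by
    rw [← pow_succ', Nat.sub_add_cancel hk0]
  have hrD : ∑ x, r x < D / 2 := by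
    have h1 : 2 * k ^ k * Neg < D * (α * n) ^ (k - 1) := by
      rw [mul_pow, ← div_lt_iff₀ (by positivity)]
      rwa [div_div, div_mul_eq_mul_div] at hu
    have h2 : (α * n) ^ (k - 1) * ∑ x, r x < (α * n) ^ (k - 1) * (D / 2) := by
      refine lt_of_le_of_lt hsum ?_
      rw [hkk] at h1
      linarith
    exact lt_of_mul_lt_mul_left h2 (by positivity)
  have ha : 0 < a := by
    by_contra! h
    have h1 : D ≤ ∑ x, r x := by
      rw [hD, ← sum_neg_distrib]
      refine sum_le_sum fun x _ => le_trans ?_ (le_max_left _ _)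
      nlinarith
    linarith
  set L := univ.filter fun x => u x < a with hL
  let x' : V → ℝ := fun x => u x + r x + if x ∈ L then (k - 1) * a else -a
  have hx'0 : ∀ x, 0 ≤ x' x := by
    intro x
    simp only [x']
    split_ifs with h
    · have := le_max_left (-(u x + (k - 1) * a)) 0
      simp only [r]
      linarith
    · have h2 : a ≤ u x := by simpa [hL] using h
      have := hr0 x
      linarith
  have hx'sum : ∑ x, x' x = -D + ∑ x, r x + a * (k * L.card - n) := by
    have h1 : ∀ x, (if x ∈ L then (k - 1) * a else -a) = (if x ∈ L then k * a else 0) + -a := by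
      intro x
      split_ifs <;> ring
    simp only [x', h1]
    rw [sum_add_distrib, sum_add_distrib, sum_add_distrib, sum_ite_mem, univ_inter, sum_const,
      sum_const, card_univ, nsmul_eq_mul, nsmul_eq_mul, ← hnV, hD]
    ring
  have hx'nonneg : 0 ≤ ∑ x, x' x := sum_nonneg fun x _ => hx'0 x
  have hLm : (L.card : ℝ) ≤ m := by exact_mod_cast ha2.le
  have hLn : (k : ℝ) * L.card - n ≤ 3 * α * k * n := by
    have : (L.card : ℝ) ≤ N + 3 * α * n := by linarith
    calc (k : ℝ) * L.card - n ≤ k * (N + 3 * α * n) - n := by gcongr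
      _ = _ := by
        rw [hnN]
        ring
  have hDa : D ≤ 6 * α * k * n * a := by
    have : a * (k * L.card - n) ≤ a * (3 * α * k * n) := by gcongr
    linarith
  have hNL : N ≤ L.card := by
    have h1 : 0 < a * (k * L.card - n) := by linarith
    have h2 : 0 < k * L.card - n := pos_of_mul_pos_right h1 ha.le
    have h3 : (k : ℝ) * N ≤ k * L.card := by linarith
    have h4 : (N : ℝ) ≤ L.card := le_of_mul_le_mul_left h3 (by linarith)
    exact_mod_cast h4
  obtain ⟨S, hSL, hSN⟩ := exists_subset_card_eq hNL
  let B : Finset V := univ.filter fun x => a / 2 ≤ x' x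
  have hB : (B.card : ℝ) ≤ 6 * α * k * n := by
    have h1 : B.card * (a / 2) ≤ ∑ x, x' x := by
      rw [← nsmul_eq_mul, ← sum_const]
      exact (sum_le_sum fun x hx => (mem_filter.mp hx).2).trans
        (sum_le_sum_of_subset_of_nonneg (subset_univ _) fun x _ _ => hx'0 x)
    have h2 : a * (k * L.card - n) ≤ a * (3 * α * k * n) := by gcongr
    have h3 : B.card * (a / 2) ≤ 6 * α * k * n * (a / 2) := by linarith
    exact le_of_mul_le_mul_right h3 (by linarith)
  refine ⟨S, by rw [hSN, hN, Nat.mul_div_cancel_left _ hk0], ?_⟩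
  by_contra! hmany
  rw [← hnV] at hmany
  have hsplit := card_filter_disjoint_ge hH S B
  set F := H.filter fun e => 2 ≤ (e ∩ S).card ∧ Disjoint e B with hF
  have hFcard : γ / 2 * n ^ k ≤ F.card := by
    have h1 : ((H.filter fun e => 2 ≤ (e ∩ S).card).card : ℝ) ≤
        F.card + B.card * n ^ (k - 1) := by
      rw [hnV]
      exact_mod_cast hsplit
    have h2 : n ^ k = n * n ^ (k - 1) := by
      rw [← pow_succ', Nat.sub_add_cancel hk0]
    have h3 : B.card * n ^ (k - 1) ≤ γ / 2 * n ^ k := by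
      rw [h2, ← mul_assoc]
      gcongr
      refine hB.trans ?_
      gcongr ?_ * n
      linarith
    linarith
  have hka : 0 < k * a := by positivity
  have hFneg : F.card * (k * a / 2) ≤ Neg := by
    have h1 : ∀ e ∈ F, k * a / 2 ≤ max (-∑ x ∈ e, u x) 0 := by
      intro e he
      obtain ⟨he, he2, heB⟩ := mem_filter.mp he
      refine le_trans ?_ (le_max_left _ _)
      have h2 : ∀ x ∈ e, u x ≤ 3 * a / 2 - if x ∈ S then k * a else 0 := by
        intro x hx
        have h3 : x' x < a / 2 := by
          by_contra! h
          exact disjoint_left.mp heB hx (mem_filter.mpr ⟨mem_univ _, h⟩)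
        have h4 := hr0 x
        simp only [x'] at h3
        by_cases hxS : x ∈ S
        · rw [if_pos (hSL hxS)] at h3
          rw [if_pos hxS]
          linarith
        · rw [if_neg hxS]
          split_ifs at h3 <;> linarith
      have h3 := sum_le_sum h2
      rw [sum_sub_distrib, sum_const, sum_ite_mem, sum_const, hH e he, nsmul_eq_mul,
        nsmul_eq_mul] at h3
      have h4 : (2 : ℝ) ≤ (e ∩ S).card := by exact_mod_cast he2
      have h5 : 2 * (k * a) ≤ (e ∩ S).card * (k * a) := by gcongr
      linarith
    rw [← nsmul_eq_mul, ← sum_const]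
    exact (sum_le_sum h1).trans
      (sum_le_sum_of_subset_of_nonneg (filter_subset _ _) fun _ _ _ => le_max_right _ _)
  have hγ : 0 < γ := lt_of_lt_of_le (by positivity) hαγ
  have h1 : 2 / n ^ (k - 1) * Neg < D := by
    refine lt_of_le_of_lt ?_ hu
    gcongr
    rw [le_div_iff₀ hαp]
    have : (1 : ℝ) ≤ k ^ k := one_le_pow₀ (by linarith)
    linarith
  have h2 : 2 / n ^ (k - 1) * (γ / 2 * n ^ k * (k * a / 2)) < 6 * α * k * n * a := by
    refine lt_of_le_of_lt ?_ (h1.trans_le hDa)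
    gcongr
    refine le_trans ?_ hFneg
    gcongr
  have h3 : 2 / n ^ (k - 1) * (γ / 2 * n ^ k * (k * a / 2)) = γ / 2 * (k * n * a) := by
    have : n ^ k = n * n ^ (k - 1) := by
      rw [← pow_succ', Nat.sub_add_cancel hk0]
    rw [this]
    field_simp
  rw [h3] at h2
  have h4 : 6 * α * k * n * a ≤ γ / 2 * (k * n * a) := by
    have h5 : 6 * α ≤ γ / 2 := by nlinarith
    calc 6 * α * k * n * a = 6 * α * (k * n * a) := by ring
      _ ≤ _ := by gcongr
  linarith

theorem card_filter_image_eq_and_apply_eq {Y : Type*} [Fintype Y] [DecidableEq Y] {k : ℕ}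
    (i : Fin k) {e : Finset Y} (he : e.card = k) {x : Y} (hx : x ∈ e) :
    (univ.filter fun v : Fin k → Y => univ.image v = e ∧ v i = x).card = (k - 1).factorial := by
  have hle : ∀ y ∈ e, ∀ z ∈ e,
      (univ.filter fun v : Fin k → Y => univ.image v = e ∧ v i = y).card ≤
        (univ.filter fun v : Fin k → Y => univ.image v = e ∧ v i = z).card := by
    intro y hy z hz
    refine card_le_card_of_injOn (fun v => Equiv.swap y z ∘ v) ?_ ?_
    · intro v hv
      obtain ⟨-, hve, hvi⟩ := mem_filter.mp (mem_coe.mp hv)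
      refine mem_coe.mpr (mem_filter.mpr ⟨mem_univ _, ?_, by simp [hvi]⟩)
      rw [← image_image, hve]
      refine eq_of_subset_of_card_le (fun a ha => ?_)
        (card_image_of_injective _ (Equiv.injective _)).ge
      obtain ⟨b, hb, rfl⟩ := mem_image.mp ha
      rw [Equiv.swap_apply_def]
      split_ifs <;> assumption
    · intro v _ v' _ h
      exact (Equiv.injective (Equiv.swap y z)).comp_left h
  have htotal : (univ.filter fun v : Fin k → Y => univ.image v = e).card = k.factorial := by
    have h1 : Fintype.card (Fin k ≃ e) = k.factorial := by
      rw [Fintype.card_equiv (e.equivFinOfCardEq he).symm, Fintype.card_fin]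
    rw [← h1, ← card_univ]
    symm
    refine card_bij (fun σ _ j => (σ j : Y)) ?_ ?_ ?_
    · intro σ _
      refine mem_filter.mpr ⟨mem_univ _, ?_⟩
      ext y
      simp only [mem_image, mem_univ, true_and]
      constructor
      · rintro ⟨j, rfl⟩
        exact (σ j).2
      · intro hy
        exact ⟨σ.symm ⟨y, hy⟩, by simp⟩
    · intro σ _ σ' _ h
      ext j
      exact congrFun h j
    · intro v hv
      have hv := (mem_filter.mp hv).2
      have hmem : ∀ j, v j ∈ e := fun j => hv ▸ mem_image_of_mem _ (mem_univ j)
      have hinj : Function.Injective v := by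
        have : (univ.image v).card = (univ : Finset (Fin k)).card := by simp [hv, he]
        simpa using card_image_iff.mp this
      refine ⟨Equiv.ofBijective (fun j => (⟨v j, hmem j⟩ : e)) ?_, mem_univ _, ?_⟩
      · rw [Fintype.bijective_iff_injective_and_card]
        exact ⟨fun j j' h => hinj (congrArg Subtype.val h), by simp [he]⟩
      · ext j
        rfl
  have hsum := card_eq_sum_card_fiberwise (s := univ.filter fun v : Fin k → Y => univ.image v = e)
    (t := e) (f := fun v => v i) (by
      intro v hv
      have hv := (mem_filter.mp (mem_coe.mp hv)).2
      exact hv ▸ mem_image_of_mem _ (mem_univ i))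
  simp only [filter_filter] at hsum
  rw [sum_congr rfl fun y hy => le_antisymm (hle y hy x hx) (hle x hx y hy), sum_const, he,
    htotal, smul_eq_mul] at hsum
  have hk : 0 < k := i.pos
  rw [← Nat.mul_factorial_pred hk.ne'] at hsum
  exact (Nat.eq_of_mul_eq_mul_left hk hsum).symm

theorem sum_filter_apply_eq_image {Y : Type*} [Fintype Y] [DecidableEq Y] {k : ℕ}
    (i : Fin k) (w : Finset Y → ℝ) (hw : ∀ e, w e ≠ 0 → e.card = k) (x : Y) :
    ∑ v : Fin k → Y with v i = x, w (univ.image v) =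
      (k - 1).factorial * ∑ e with x ∈ e, w e := by
  rw [mul_sum, ← sum_fiberwise_of_maps_to (t := univ.filter fun e => x ∈ e)
    (g := fun v : Fin k → Y => univ.image v)]
  · refine sum_congr rfl fun e he => ?_
    by_cases h : w e = 0
    · rw [h, mul_zero]
      refine sum_eq_zero fun v hv => ?_
      rw [(mem_filter.mp hv).2, h]
    · rw [sum_congr rfl fun v hv => congrArg w (mem_filter.mp hv).2, sum_const, nsmul_eq_mul,
        ← card_filter_image_eq_and_apply_eq i (hw e h) (mem_filter.mp he).2, filter_filter]
      simp_rw [and_comm]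
  · intro v hv
    have hv := (mem_filter.mp hv).2
    exact mem_filter.mpr ⟨mem_univ _, hv ▸ mem_image_of_mem _ (mem_univ i)⟩

/-- A matching can be completed to a partition of the vertex set into cells of size `k`. -/
theorem exists_equiv_extending_matching {Y : Type} [Fintype Y] [DecidableEq Y] {k N : ℕ}
    (hN : Fintype.card Y = k * N) {M : Finset (Finset Y)} (hM : ∀ e ∈ M, e.card = k)
    (hMd : (M : Set (Finset Y)).PairwiseDisjoint id) (hMN : M.card ≤ N) :
    ∃ θ : (M ⊕ Fin (N - M.card)) × Fin k ≃ Y,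
      ∀ e : M, univ.image (fun s => θ (Sum.inl e, s)) = e := by
  let U : Finset Y := (M.biUnion id)ᶜ
  have hU : Fintype.card (Fin (N - M.card) × Fin k) = Fintype.card U := by
    have h1 : (M.biUnion id).card = M.card * k := by
      rw [card_biUnion hMd]
      exact sum_const_nat hM
    rw [Fintype.card_coe, card_compl, h1, hN, Fintype.card_prod, Fintype.card_fin,
      Fintype.card_fin, Nat.sub_mul, mul_comm k]
  let ψ := Fintype.equivOfCardEq hU
  let σ : ∀ e : M, Fin k ≃ e.1 := fun e => ((e.1).equivFinOfCardEq (hM e.1 e.2)).symm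
  let f : (M ⊕ Fin (N - M.card)) × Fin k → Y := fun p =>
    Sum.elim (fun e => (σ e p.2 : Y)) (fun j => (ψ (j, p.2) : Y)) p.1
  have hcross : ∀ (e : M) s q, (σ e s : Y) ≠ ψ q := by
    intro e s q h
    have h1 := mem_compl.mp (ψ q).2
    exact h1 (mem_biUnion.mpr ⟨e.1, e.2, h ▸ (σ e s).2⟩)
  have hf : Function.Bijective f := by
    rw [Fintype.bijective_iff_injective_and_card]
    constructor
    · rintro ⟨e | j, s⟩ ⟨e' | j', s'⟩ h
      · have hee' : e = e' := by
          by_contra hne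
          have h1 := hMd e.2 e'.2 fun h => hne (Subtype.ext h)
          refine disjoint_left.mp h1 (σ e s).2 ?_
          rw [show (σ e s : Y) = σ e' s' from h]
          exact (σ e' s').2
        subst hee'
        have : s = s' := (σ e).injective (Subtype.ext h)
        rw [this]
      · exact absurd h (hcross e s (j', s'))
      · exact absurd h.symm (hcross e' s' (j, s))
      · have := ψ.injective (Subtype.ext h)
        simp only [Prod.mk.injEq] at this
        rw [this.1, this.2]
    · simp only [Fintype.card_prod, Fintype.card_sum, Fintype.card_coe, Fintype.card_fin, hN]
      rw [Nat.add_sub_cancel' hMN, mul_comm]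
  refine ⟨Equiv.ofBijective f hf, fun e => ?_⟩
  ext y
  simp only [mem_image, mem_univ, true_and, Equiv.ofBijective_apply, f, Sum.elim_inl]
  constructor
  · rintro ⟨s, rfl⟩
    exact (σ e s).2
  · intro hy
    exact ⟨(σ e).symm ⟨y, hy⟩, by simp⟩

/-- A hypergraph with a spread perfect fractional matching has an almost perfect matching. -/
theorem exists_almost_perfect_matching (k : ℕ) (hk : 0 < k) (C η : ℝ) (hη : 0 < η) :
    ∃ N₀ : ℕ, ∀ (Y : Type) [Fintype Y] [DecidableEq Y] (N : ℕ), N₀ ≤ N →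
      Fintype.card Y = k * N → ∀ H : Finset (Finset Y), (∀ e ∈ H, e.card = k) →
        ∀ w : Finset Y → ℝ, (∀ e, 0 ≤ w e) → (∀ e, w e ≤ C / (Fintype.card Y : ℝ) ^ (k - 1)) →
          (∀ e, w e ≠ 0 → e ∈ H) → (∀ x, ∑ e with x ∈ e, w e = 1) →
          ∃ M ⊆ H, (M : Set (Finset Y)).PairwiseDisjoint id ∧ (1 - η) * N ≤ M.card := by
  classical
  obtain ⟨N₀, hN₀⟩ := exists_larger_matching k hk C η hη
  refine ⟨N₀ + 1, fun Y _ _ N hN hYN H hH w w0 wC wH w1 => ?_⟩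
  obtain ⟨M, hMmem, hMmax⟩ := exists_max_image
    (H.powerset.filter fun M : Finset (Finset Y) => (M : Set (Finset Y)).PairwiseDisjoint id) card
    ⟨∅, mem_filter.mpr ⟨empty_mem_powerset _, by simp⟩⟩
  obtain ⟨hMH, hMd⟩ := mem_filter.mp hMmem
  rw [mem_powerset] at hMH
  refine ⟨M, hMH, hMd, ?_⟩
  by_contra! hsmall
  have hNpos : 0 < N := by omega
  have hMN : M.card ≤ N := by
    have : (M.card : ℝ) ≤ N := by nlinarith [(Nat.cast_nonneg N : (0 : ℝ) ≤ N)]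
    exact_mod_cast this
  obtain ⟨θ, hθ⟩ := exists_equiv_extending_matching hYN (fun e he => hH e (hMH he)) hMd hMN
  let X := M ⊕ Fin (N - M.card)
  have hX : Fintype.card X = N := by
    simp only [X, Fintype.card_sum, Fintype.card_coe, Fintype.card_fin]
    omega
  let H' : Finset (Finset (X × Fin k)) := univ.filter fun S => S.image θ ∈ H
  let g : (Fin k → X × Fin k) → ℝ := fun v =>
    (N : ℝ) ^ (k - 1) / (k - 1).factorial * w (univ.image (θ ∘ v))
  have hYpos : (0 : ℝ) < Fintype.card Y := by
    rw [hYN]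
    exact_mod_cast Nat.mul_pos hk hNpos
  obtain ⟨M', hM'H, hM'd, hM'c⟩ := hN₀ X (by omega) H' g
    (fun v => mul_nonneg (by positivity) (w0 _))
    (by
      intro v
      have h1 : (N : ℝ) ^ (k - 1) ≤ (Fintype.card Y : ℝ) ^ (k - 1) := by
        gcongr
        rw [hYN]
        exact Nat.le_mul_of_pos_left _ hk
      have h2 : (N : ℝ) ^ (k - 1) / (k - 1).factorial ≤ (Fintype.card Y : ℝ) ^ (k - 1) :=
        (div_le_self (by positivity) (by exact_mod_cast Nat.factorial_pos _)).trans h1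
      calc g v ≤ (Fintype.card Y : ℝ) ^ (k - 1) * (C / (Fintype.card Y : ℝ) ^ (k - 1)) :=
            mul_le_mul h2 (wC _) (w0 _) (by positivity)
        _ = C := by field_simp)
    (by
      intro v hv
      refine mem_filter.mpr ⟨mem_univ _, ?_⟩
      rw [image_image]
      exact wH _ (right_ne_zero_of_mul hv))
    (by
      intro i x
      have h1 := sum_filter_apply_eq_image i w (fun e he => hH e (wH e he)) (θ x)
      rw [w1, mul_one, sum_filter] at h1
      have h2 : ∑ v : Fin k → X × Fin k, (if v i = x then w (univ.image (θ ∘ v)) else 0) =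
          (k - 1).factorial := by
        rw [← h1]
        refine Fintype.sum_equiv (Equiv.arrowCongr (Equiv.refl _) θ) _ _ fun v => ?_
        simp [Equiv.arrowCongr]
      simp only [g]
      rw [← mul_sum, sum_filter, h2, hX]
      field_simp)
    (univ.image Sum.inl)
    (by
      intro c hc
      obtain ⟨e, -, rfl⟩ := mem_image.mp hc
      refine mem_filter.mpr ⟨mem_univ _, ?_⟩
      rw [image_image]
      exact (hθ e).symm ▸ hMH e.2)
    (by
      rw [card_image_of_injective _ Sum.inl_injective, card_univ, Fintype.card_coe, hX]
      exact hsmall.le)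
  rw [card_image_of_injective _ Sum.inl_injective, card_univ, Fintype.card_coe] at hM'c
  have himage : Function.Injective (image θ) := image_injective θ.injective
  have hle := hMmax (M'.image (image θ)) (by
    refine mem_filter.mpr ⟨mem_powerset.mpr ?_, ?_⟩
    · intro e he
      obtain ⟨S, hS, rfl⟩ := mem_image.mp he
      exact (mem_filter.mp (hM'H hS)).2
    · intro e he f hf hef
      obtain ⟨S, hS, rfl⟩ := mem_image.mp (mem_coe.mp he)
      obtain ⟨T, hT, rfl⟩ := mem_image.mp (mem_coe.mp hf)
      exact (disjoint_image θ.injective).mpr (hM'd hS hT fun h => hef (h ▸ rfl)))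
  rw [card_image_of_injective _ himage] at hle
  omega

theorem exists_perfect_matching_of_card_one {Y : Type*} [Fintype Y] [DecidableEq Y]
    {H : Finset (Finset Y)} (hH : ∀ e ∈ H, e.card = 1) (hcover : ∀ x, ∃ e ∈ H, x ∈ e) :
    (H : Set (Finset Y)).PairwiseDisjoint id ∧ Fintype.card Y ≤ H.card := by
  constructor
  · intro e he f hf hef
    obtain ⟨x, rfl⟩ := card_eq_one.mp (hH e he)
    obtain ⟨y, rfl⟩ := card_eq_one.mp (hH f hf)
    exact disjoint_singleton.mpr fun h => hef (h ▸ rfl)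
  · rw [← card_univ]
    refine card_le_card_of_injOn (fun x => {x}) ?_ (singleton_injective.injOn)
    intro x _
    obtain ⟨e, he, hx⟩ := hcover x
    obtain ⟨y, rfl⟩ := card_eq_one.mp (hH e he)
    rw [mem_singleton.mp hx]
    exact he

theorem stmt15 (k : ℕ) (hk : 0 < k) (γ : ℝ) (hγ : 0 < γ) :
    ∃ δ₀ : ℝ, 0 < δ₀ ∧ ∀ η α : ℝ, 0 < η → η ≤ δ₀ → 0 < α → α ≤ δ₀ →
      ∃ n₀ : ℕ, ∀ n ≥ n₀, k ∣ n →
        ∀ H : Finset (Finset (Fin n)), (∀ e ∈ H, e.card = k) →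
          ((k : ℝ) - 1) / k * n - α * n ≤ (minPosCodeg k H : ℝ) →
          (∀ v : Fin n, ∃ e ∈ H, v ∈ e) →
          IsExtremal k γ H ∨
            ∃ M ⊆ H, (M : Set (Finset (Fin n))).PairwiseDisjoint id ∧
              (1 - η) * n / k ≤ (M.card : ℝ) := by
  have hkR : (0 : ℝ) < k := by exact_mod_cast hk
  refine ⟨min (1 / 6) (γ / (12 * k)), by positivity, fun η α hη _ hα hαδ => ?_⟩
  obtain ⟨hα6, hαγ⟩ := le_min_iff.mp hαδ
  rw [le_div_iff₀ (by positivity), mul_comm] at hαγ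
  obtain rfl | hk2 := (show 1 ≤ k from hk).eq_or_lt
  · refine ⟨0, fun n _ _ H hH _ hcover => Or.inr ?_⟩
    obtain ⟨hd, hc⟩ := exists_perfect_matching_of_card_one hH hcover
    refine ⟨H, Subset.rfl, hd, ?_⟩
    rw [Fintype.card_fin] at hc
    have h1 : (n : ℝ) ≤ H.card := by exact_mod_cast hc
    have h2 : (0 : ℝ) ≤ η * n := by positivity
    rw [Nat.cast_one, div_one]
    linarith
  · obtain ⟨N₀, hN₀⟩ :=
      exists_almost_perfect_matching k hk (2 * k ^ k / α ^ (k - 1)) η hη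
    refine ⟨max (k * N₀) ⌈1 / α⌉₊, fun n hn hkn H hH hcodeg hcover => ?_⟩
    obtain ⟨hn1, hn2⟩ := max_le_iff.mp hn
    have hαn : 1 ≤ α * n := by
      have := (Nat.le_ceil (1 / α)).trans (Nat.cast_le.mpr hn2)
      rw [div_le_iff₀ hα] at this
      linarith
    obtain ⟨N, rfl⟩ := hkn
    have hcard : Fintype.card (Fin (k * N)) = k * N := Fintype.card_fin _
    obtain ⟨w, w0, wC, wH, w1⟩ | ⟨u, hu⟩ := exists_bounded_perfect_weight_or_dual H
      (c := 2 * k ^ k / α ^ (k - 1) / ((k * N : ℕ) : ℝ) ^ (k - 1)) (by positivity)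
    · right
      obtain ⟨M, hMH, hMd, hM⟩ := hN₀ (Fin (k * N)) N (Nat.le_of_mul_le_mul_left hn1 hk) hcard H
        hH w w0 (by rwa [hcard]) wH w1
      refine ⟨M, hMH, hMd, ?_⟩
      convert hM using 1
      push_cast
      field_simp
    · left
      refine isExtremal_of_dual hk2 hα hα6 hαγ hH ?_ ?_ ?_ hcover u ?_
      all_goals rw [hcard]
      · exact hαn
      · exact dvd_mul_right _ _
      · exact hcodeg
      · exact hu
end
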